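/- arXiv:1008.0828 — 2 statements merged into one kernel-verified Lean document; each statement's English description precedes it below -/
import Mathlib

section
/- If m + n > 0, the operators B_n and C_m on symmetric functions satisfy B_n C_m = q C_m B_n. -/
open Finset MvPolynomial

noncomputable section

/-- Base field `F = ℚ(q)`. -/
abbrev F : Type := RatFunc ℚ

/-- The parameter `q`. -/
noncomputable def q : F := RatFunc.X

/-- The ring of symmetric functions `Λ = F[p₁, p₂, p₃, …]`, where the variable
`X k` represents the power sum `p_{k+1}`. -/
abbrev SymF : Type := MvPolynomial ℕ F

/-- `pp k` is the power sum `p_k` for `k ≥ 1`. -/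
noncomputable def pp (k : ℕ) : SymF := MvPolynomial.X (k - 1)

/-- Complete homogeneous symmetric functions, via Newton's identity
`(n+1) h_{n+1} = ∑_{k=1}^{n+1} p_k h_{n+1-k}`. -/
noncomputable def hN : ℕ → SymF
  | 0 => 1
  | n + 1 => ((n : F) + 1)⁻¹ • ∑ k ∈ Finset.range (n + 1), pp (k + 1) * hN (n - k)
  termination_by n => n
  decreasing_by omega

/-- Elementary symmetric functions, via Newton's identity
`(n+1) e_{n+1} = ∑_{k=1}^{n+1} (-1)^{k-1} p_k e_{n+1-k}`. -/
noncomputable def eN : ℕ → SymF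
  | 0 => 1
  | n + 1 => ((n : F) + 1)⁻¹ • ∑ k ∈ Finset.range (n + 1), ((-1 : F) ^ k) • (pp (k + 1) * eN (n - k))
  termination_by n => n
  decreasing_by omega

/-- `hh m = h_m` for `m ≥ 0` and `0` for `m < 0`. -/
noncomputable def hh (m : ℤ) : SymF := if 0 ≤ m then hN m.toNat else 0

/-- `ee m = e_m` for `m ≥ 0` and `0` for `m < 0`. -/
noncomputable def ee (m : ℤ) : SymF := if 0 ≤ m then eN m.toNat else 0

/-- The plethystic translation `f[X] ↦ f[X + (1-q)z]`, determined by
`p_k ↦ p_k + (1-q^k) z^k`.  The coefficient of `z^r` computes `h_r[X(1-q)]^⊥ f`. -/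
noncomputable def Tq : SymF →ₐ[F] Polynomial SymF :=
  MvPolynomial.aeval fun k =>
    Polynomial.C (MvPolynomial.X k) +
      Polynomial.C (MvPolynomial.C (1 - q ^ (k + 1))) * Polynomial.X ^ (k + 1)

/-- The operator `h_r[X(1-q)]^⊥`. -/
noncomputable def Dq (r : ℕ) (P : SymF) : SymF := (Tq P).coeff r

/-- The plethystic translation `f[X] ↦ f[X - z]`, determined by `p_k ↦ p_k - z^k`;
one has `f[X - z] = ∑_k (-z)^k (e_k^⊥ f)[X]`. -/
noncomputable def T1 : SymF →ₐ[F] Polynomial SymF :=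
  MvPolynomial.aeval fun k =>
    Polynomial.C (MvPolynomial.X k) - Polynomial.X ^ (k + 1)

/-- The operator `e_r^⊥`. -/
noncomputable def eperp (r : ℕ) (P : SymF) : SymF := ((-1 : F) ^ r) • (T1 P).coeff r

/-- The Hall–Littlewood creation operator
`ℂ_m P = (-1/q)^{m-1} ∑_{r ≥ 0} q^{-r} h_{m+r} · (h_r[X(1-q)])^⊥ P`
(the sum is finite: terms with `r > deg_z (Tq P)` vanish). -/
noncomputable def Cop (m : ℤ) (P : SymF) : SymF :=
  ((-q⁻¹ : F) ^ (m - 1)) •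
    ∑ r ∈ Finset.range ((Tq P).natDegree + 1), ((q⁻¹ : F) ^ r) • (hh (m + r) * Dq r P)

/-- The creation operator `𝔹_m P = ∑_{r ≥ 0} (-1)^r e_{m+r} · (h_r[X(1-q)])^⊥ P`. -/
noncomputable def Bop (m : ℤ) (P : SymF) : SymF :=
  ∑ r ∈ Finset.range ((Tq P).natDegree + 1), ((-1 : F) ^ r) • (ee (m + r) * Dq r P)

/-- The Bernstein (Schur) creation operator `S_m P = ∑_{r ≥ 0} (-1)^r h_{m+r} · e_r^⊥ P`. -/
noncomputable def Sop (m : ℤ) (P : SymF) : SymF :=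
  ∑ r ∈ Finset.range ((T1 P).natDegree + 1), ((-1 : F) ^ r) • (hh (m + r) * eperp r P)

/-- `C_α[X;q] = ℂ_{α₁} ℂ_{α₂} ⋯ ℂ_{α_ℓ}(1)`. -/
noncomputable def Cfun : List ℕ → SymF
  | [] => 1
  | a :: l => Cop a (Cfun l)

/-- `B_α[X;q] = 𝔹_{α_ℓ} 𝔹_{α_{ℓ-1}} ⋯ 𝔹_{α₁}(1)`. -/
noncomputable def Bfun (l : List ℕ) : SymF := l.foldl (fun acc a => Bop a acc) 1

end

/-- The touch set `{0} ∪ Des(c)` of a composition `c` of `n`: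
the set of partial sums `c₁ + ⋯ + c_i` for `0 ≤ i < ℓ(c)` (0-based touch rows). -/
def touchSet {n : ℕ} (c : Composition n) : Finset ℕ :=
  (Finset.range c.length).image fun i => c.sizeUpTo i

/-- The descent set of a composition: its proper nonzero partial sums. -/
def DesSet {n : ℕ} (c : Composition n) : Finset ℕ := (touchSet c).erase 0

/-- `Refines β α` means `β ≤ α`: `β` is finer than `α`, i.e. `Des(α) ⊆ Des(β)`. -/
abbrev Refines {n : ℕ} (β α : Composition n) : Prop := touchSet α ⊆ touchSet β

/-- `doffC α β = doff_α(DP(β))` for `β ≤ α`: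
`∑_{k=1}^{ℓ(α)} (ℓ(α)-k) r_k` where `r_k` is the number of parts of `β`
lying inside the `k`-th part of `α`. -/
def doffC {n : ℕ} (α β : Composition n) : ℕ :=
  ∑ k ∈ Finset.range α.length,
    (α.length - 1 - k) *
      ((touchSet β).filter fun s => α.sizeUpTo k ≤ s ∧ s < α.sizeUpTo (k + 1)).card

/-- The reversed composition. -/
def revC {n : ℕ} (c : Composition n) : Composition n :=
  ⟨c.blocks.reverse, fun hi => c.blocks_pos (List.mem_reverse.mp hi), by
    rw [List.sum_reverse]; exact c.blocks_sum⟩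

/-- A Dyck path from `(0,0)` to `(n,n)`, encoded by its arm sequence:
`arm i` is the number of cells between the path and the diagonal in row `i+1`
(rows are 0-indexed here). -/
structure DyckPath (n : ℕ) where
  arm : ℕ → ℕ
  arm_zero : 0 < n → arm 0 = 0
  arm_step : ∀ i, i + 1 < n → arm (i + 1) ≤ arm i + 1
  arm_outside : ∀ i, n ≤ i → arm i = 0

/-- `area(D) = ∑ᵢ aᵢ`. -/
def area {n : ℕ} (D : DyckPath n) : ℕ := ∑ i ∈ Finset.range n, D.arm i

/-- `dinv(D) = #{(i,j) : i < j, aᵢ - aⱼ ∈ {0,1}}`. -/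
def dinv {n : ℕ} (D : DyckPath n) : ℕ :=
  ((Finset.range n ×ˢ Finset.range n).filter fun p =>
      p.1 < p.2 ∧ (D.arm p.1 = D.arm p.2 ∨ D.arm p.1 = D.arm p.2 + 1)).card

/-- `IsTouch D α` says that `touch(D) = α`: the rows where the arm vanishes are
exactly the partial sums of `α`. -/
def IsTouch {n : ℕ} (D : DyckPath n) (α : Composition n) : Prop :=
  ∀ i < n, (D.arm i = 0 ↔ i ∈ touchSet α)

/-- `doff_α(D)`, for a path `D` whose touch composition refines `α`. -/
def doffD {n : ℕ} (α : Composition n) (D : DyckPath n) : ℕ :=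
  ∑ k ∈ Finset.range α.length,
    (α.length - 1 - k) *
      ((Finset.Ico (α.sizeUpTo k) (α.sizeUpTo (k + 1))).filter fun i => D.arm i = 0).card

instance {n : ℕ} : DecidableEq (Composition n) := fun a b =>
  decidable_of_iff (a.blocks = b.blocks) ⟨fun h => by cases a; cases b; simpa using h,
    fun h => by rw [h]⟩

noncomputable section

/-- Plethystic evaluation at the alphabet `1 - q`: the algebra map `p_k ↦ 1 - q^k`. -/
noncomputable def evOneMinusQ : SymF →ₐ[F] F := MvPolynomial.aeval fun k => 1 - q ^ (k + 1)

/-- The cells of the Young diagram of a partition given as a (weakly decreasing)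
list of parts: `(i, j)` with `j < lᵢ` (row `i`, column `j`, both 0-based). -/
def pcells (l : List ℕ) : Finset (ℕ × ℕ) :=
  (Finset.range l.length ×ˢ Finset.range (l.foldr max 0)).filter fun c => c.2 < l.getD c.1 0

/-- The arm of a cell: number of cells strictly to its right in its row. -/
def armC (l : List ℕ) (c : ℕ × ℕ) : ℕ := l.getD c.1 0 - c.2 - 1

/-- The leg of a cell: number of cells of the diagram in its column in later rows. -/
def legC (l : List ℕ) (c : ℕ × ℕ) : ℕ :=
  ((Finset.Ico (c.1 + 1) l.length).filter fun i => c.2 < l.getD i 0).card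

/-- The `k`-th part (`k ≥ 1`) of the conjugate partition: `μ'_k = #{i : μᵢ ≥ k}`. -/
def conjPart (l : List ℕ) (k : ℕ) : ℕ := l.countP fun x => k ≤ x

/-- The multiplicity `m_i(μ')` of `i` among the parts of the conjugate partition. -/
def mConj (l : List ℕ) (i : ℕ) : ℕ :=
  ((Finset.Icc 1 l.headI).filter fun k => conjPart l k = i).card

/-- `n(μ') = ∑ (k-1) μ'_k`. -/
def nConj (l : List ℕ) : ℕ := ∑ k ∈ Finset.Icc 1 l.headI, (k - 1) * conjPart l k

/-- The `q`-Pochhammer symbol `(q;q)_k = ∏_{j=1}^k (1 - q^j)` as an element of `F`. -/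
noncomputable def qpoch (k : ℕ) : F := ∏ j ∈ Finset.Icc 1 k, (1 - q ^ j)

end

namespace HallLittlewood

theorem q_ne_zero : q ≠ 0 := RatFunc.X_ne_zero

theorem neg_one_pow_mul_self {R : Type*} [CommRing R] (n : ℕ) :
    (-1 : R) ^ n * (-1) ^ n = 1 := by
  rw [← mul_pow, neg_mul_neg, one_mul, one_pow]

theorem natCast_add_one_mul_hN (n : ℕ) :
    ((n : SymF) + 1) * hN (n + 1) = ∑ k ∈ range (n + 1), pp (k + 1) * hN (n - k) := by
  have h : ((n : F) + 1) ≠ 0 := by exact_mod_cast n.succ_ne_zero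
  rw [hN, show ((n : SymF) + 1) = C ((n : F) + 1) by simp, ← smul_eq_C_mul, smul_inv_smul₀ h]

theorem natCast_add_one_mul_eN (n : ℕ) :
    ((n : SymF) + 1) * eN (n + 1) =
      ∑ k ∈ range (n + 1), (-1) ^ k * (pp (k + 1) * eN (n - k)) := by
  have h : ((n : F) + 1) ≠ 0 := by exact_mod_cast n.succ_ne_zero
  rw [eN, show ((n : SymF) + 1) = C ((n : F) + 1) by simp, ← smul_eq_C_mul, smul_inv_smul₀ h]
  simp [smul_eq_C_mul]

/-- The generating series of the power sums, `∑ p_{k+1} t^k`. -/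
noncomputable def pSeries : PowerSeries SymF := .mk fun k => pp (k + 1)

/-- The generating series `H(t) = ∑ h_n t^n`. -/
noncomputable def hSeries : PowerSeries SymF := .mk hN

/-- The generating series `E(-t) = ∑ (-1)^n e_n t^n`. -/
noncomputable def eSeries : PowerSeries SymF := .mk fun n => (-1) ^ n * eN n

open scoped PowerSeries in
theorem derivative_hSeries : d⁄dX SymF hSeries = pSeries * hSeries := by
  ext1 n
  rw [PowerSeries.coeff_derivative, PowerSeries.coeff_mul]
  simp only [hSeries, pSeries, PowerSeries.coeff_mk]
  rw [Finset.Nat.sum_antidiagonal_eq_sum_range_succ (fun i j => pp (i + 1) * hN j),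
    mul_comm, natCast_add_one_mul_hN]

open scoped PowerSeries in
theorem derivative_eSeries : d⁄dX SymF eSeries = -(pSeries * eSeries) := by
  ext1 n
  rw [PowerSeries.coeff_derivative, map_neg, PowerSeries.coeff_mul]
  simp only [eSeries, pSeries, PowerSeries.coeff_mk]
  rw [Finset.Nat.sum_antidiagonal_eq_sum_range_succ
      (fun i j => pp (i + 1) * ((-1) ^ j * eN j)),
    mul_assoc, mul_comm (eN _), natCast_add_one_mul_eN, mul_sum, ← sum_neg_distrib]
  refine sum_congr rfl fun k hk => ?_
  obtain ⟨j, rfl⟩ := Nat.exists_eq_add_of_le (Nat.lt_succ_iff.mp (mem_range.mp hk))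
  have : ((-1 : SymF) ^ k) * (-1) ^ k = 1 := neg_one_pow_mul_self k
  rw [Nat.add_sub_cancel_left, pow_succ, pow_add]
  linear_combination -((-1) ^ j * pp (k + 1) * eN j) * this

open scoped PowerSeries in
theorem hSeries_mul_eSeries : hSeries * eSeries = 1 := by
  apply PowerSeries.derivative.ext
  · rw [Derivation.leibniz, derivative_hSeries, derivative_eSeries, PowerSeries.derivative_one]
    simp only [smul_eq_mul]
    ring
  · simp [hSeries, eSeries, hN, eN]

open scoped PowerSeries in
theorem derivative_map {R S : Type*} [CommRing R] [CommRing S] (f : R →+* S) (G : PowerSeries R) :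
    d⁄dX S (PowerSeries.map f G) = PowerSeries.map f (d⁄dX R G) := by
  ext n
  simp [PowerSeries.coeff_derivative]

/-- `p_k ↦ p_k + (1 - q^k) z^k` on the generating series of the power sums. -/
theorem map_Tq_pSeries :
    (PowerSeries.map (Tq : SymF →+* Polynomial SymF) pSeries) =
      PowerSeries.map Polynomial.C pSeries +
        .mk (fun k => Polynomial.X ^ (k + 1)) -
        .mk (fun k => (Polynomial.C (C q) * Polynomial.X) ^ (k + 1)) := by
  ext1 n
  simp [pSeries, pp, Tq]
  ring

theorem one_sub_mul_mk_pow {R : Type*} [CommRing R] (z : R) :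
    (1 - PowerSeries.C z * PowerSeries.X) * PowerSeries.mk (fun k => z ^ (k + 1)) =
      PowerSeries.C z := by
  ext n
  cases n with
  | zero => simp
  | succ n => simp [sub_mul, mul_assoc, PowerSeries.coeff_succ_X_mul]; ring

open scoped PowerSeries in
theorem derivative_mul {R : Type*} [CommRing R] (G K : PowerSeries R) :
    d⁄dX R (G * K) = G * d⁄dX R K + K * d⁄dX R G := by
  simp [Derivation.leibniz]

open scoped PowerSeries in
/-- The power series `(1 - b t) / (1 - a t)` is determined by its logarithmic derivative. -/
theorem one_sub_mul_eq_of_derivative {R : Type*} [CommRing R] [IsAddTorsionFree R]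
    (a b : R) (W : PowerSeries R) (hW : PowerSeries.constantCoeff W = 1)
    (hd : d⁄dX R W =
      (PowerSeries.mk (fun k => a ^ (k + 1)) - PowerSeries.mk (fun k => b ^ (k + 1))) * W) :
    (1 - PowerSeries.C a * PowerSeries.X) * W = 1 - PowerSeries.C b * PowerSeries.X := by
  have ha := one_sub_mul_mk_pow a
  set A : PowerSeries R := PowerSeries.mk fun k => a ^ (k + 1)
  set B : PowerSeries R := PowerSeries.mk fun k => b ^ (k + 1)
  set S : PowerSeries R := PowerSeries.mk fun k => b ^ k
  have hS : (1 - PowerSeries.C b * PowerSeries.X) * S = 1 := by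
    ext n
    cases n with
    | zero => simp [S]
    | succ n => simp [S, sub_mul, mul_assoc, PowerSeries.coeff_succ_X_mul, pow_succ']
  have hCS : B = PowerSeries.C b * S := by
    ext n; simp [B, S, pow_succ']
  have hdS : d⁄dX R S = B * S := by
    have h := congr(S * d⁄dX R $hS)
    simp only [derivative_mul, map_sub, PowerSeries.derivative_one, PowerSeries.derivative_C,
      PowerSeries.derivative_X] at h
    linear_combination h - d⁄dX R S * hS - S * hCS
  have key : (1 - PowerSeries.C a * PowerSeries.X) * W * S = 1 := by
    apply PowerSeries.derivative.ext
    · simp only [derivative_mul, map_sub, PowerSeries.derivative_one, PowerSeries.derivative_C,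
        PowerSeries.derivative_X, hdS, hd]
      linear_combination W * S * ha
    · simp [hW, S]
  linear_combination (1 - PowerSeries.C b * PowerSeries.X) * key -
    (1 - PowerSeries.C a * PowerSeries.X) * W * hS

/-- `H[X + (1-q)z]` in terms of `H[X]`. -/
theorem map_Tq_hSeries :
    (1 - PowerSeries.C Polynomial.X * PowerSeries.X) *
        PowerSeries.map (Tq : SymF →+* Polynomial SymF) hSeries =
      (1 - PowerSeries.C (Polynomial.C (C q) * Polynomial.X) * PowerSeries.X) *
        PowerSeries.map Polynomial.C hSeries := by
  have hHE := congr(PowerSeries.map (Polynomial.C (R := SymF)) $hSeries_mul_eSeries)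
  rw [map_mul, map_one] at hHE
  have h := one_sub_mul_eq_of_derivative (Polynomial.X : Polynomial SymF)
    (Polynomial.C (C q) * Polynomial.X)
    (PowerSeries.map (Tq : SymF →+* Polynomial SymF) hSeries *
      PowerSeries.map Polynomial.C eSeries) (by
      rw [map_mul, ← PowerSeries.coeff_zero_eq_constantCoeff_apply,
        ← PowerSeries.coeff_zero_eq_constantCoeff_apply, PowerSeries.coeff_map,
        PowerSeries.coeff_map]
      simp [hSeries, eSeries, hN, eN]) (by
      rw [derivative_mul, derivative_map, derivative_map, derivative_hSeries,
        derivative_eSeries, map_mul, map_Tq_pSeries]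
      simp only [map_neg, map_mul]
      ring)
  rw [← h]
  linear_combination -(1 - PowerSeries.C Polynomial.X * PowerSeries.X) *
        PowerSeries.map (Tq : SymF →+* Polynomial SymF) hSeries * hHE

/-- `E[X + (1-q)z]` in terms of `E[X]`. -/
theorem map_Tq_eSeries :
    (1 - PowerSeries.C (Polynomial.C (C q) * Polynomial.X) * PowerSeries.X) *
        PowerSeries.map (Tq : SymF →+* Polynomial SymF) eSeries =
      (1 - PowerSeries.C Polynomial.X * PowerSeries.X) *
        PowerSeries.map Polynomial.C eSeries := by
  have hHE := congr(PowerSeries.map (Polynomial.C (R := SymF)) $hSeries_mul_eSeries)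
  have hTHE := congr(PowerSeries.map (Tq : SymF →+* Polynomial SymF) $hSeries_mul_eSeries)
  rw [map_mul, map_one] at hHE hTHE
  have h := map_Tq_hSeries
  generalize PowerSeries.map (Tq : SymF →+* Polynomial SymF) hSeries = H' at *
  generalize PowerSeries.map (Tq : SymF →+* Polynomial SymF) eSeries = E' at *
  generalize PowerSeries.map (Polynomial.C (R := SymF)) hSeries = H at *
  generalize PowerSeries.map (Polynomial.C (R := SymF)) eSeries = E at *
  linear_combination (1 - PowerSeries.C Polynomial.X * PowerSeries.X) * E * hTHE
    - (1 - PowerSeries.C (Polynomial.C (C q) * Polynomial.X) * PowerSeries.X) * E' * hHE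
    - E * E' * h

theorem Tq_hN_succ (n : ℕ) :
    Tq (hN (n + 1)) = Polynomial.X * Tq (hN n) + Polynomial.C (hN (n + 1)) -
      Polynomial.C (C q) * Polynomial.X * Polynomial.C (hN n) := by
  have h := congr(PowerSeries.coeff (n + 1) $map_Tq_hSeries)
  simp [hSeries, sub_mul, mul_assoc, PowerSeries.coeff_succ_X_mul] at h
  linear_combination h

theorem Tq_eN_succ (n : ℕ) :
    Tq (eN (n + 1)) = -(Polynomial.C (C q) * Polynomial.X * Tq (eN n)) +
      Polynomial.C (eN (n + 1)) + Polynomial.X * Polynomial.C (eN n) := by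
  have h := congr(PowerSeries.coeff (n + 1) $map_Tq_eSeries)
  simp [eSeries, sub_mul, mul_assoc, PowerSeries.coeff_succ_X_mul] at h
  have h1 : ((-1 : Polynomial SymF) ^ n) * (-1) ^ n = 1 := neg_one_pow_mul_self n
  linear_combination -(-1) ^ n * h - (Tq (eN (n + 1)) +
    Polynomial.C (C q) * Polynomial.X * Tq (eN n) - Polynomial.C (eN (n + 1)) -
    Polynomial.X * Polynomial.C (eN n)) * h1

theorem coeff_Tq_hN (n j : ℕ) :
    (Tq (hN n)).coeff j = (if j = 0 then 1 else 1 - C q) * hh ((n : ℤ) - j) := by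
  induction n generalizing j with
  | zero =>
    rcases j with _ | j
    · simp [hh, hN]
    · have : ¬ (0 ≤ (0 : ℤ) - (j + 1 : ℕ)) := by omega
      rw [hh, Nat.cast_zero, if_neg this]
      simp [hN, Polynomial.coeff_one]
  | succ n ih =>
    rw [Tq_hN_succ]
    rcases j with _ | j
    · have : (0 : ℤ) ≤ (n : ℤ) + 1 := by omega
      have h2 : ((n : ℤ) + 1).toNat = n + 1 := by omega
      simp [hh, mul_assoc, this, h2]
    · simp only [mul_assoc, Polynomial.coeff_sub, Polynomial.coeff_add, Polynomial.coeff_C_mul,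
        Polynomial.coeff_X_mul, Polynomial.coeff_C_succ, ih]
      rcases j with _ | j
      · simp [hh]; ring
      · simp

theorem coeff_Tq_eN (n j : ℕ) :
    (Tq (eN n)).coeff j =
      (if j = 0 then 1 else (1 - C q) * (-C q) ^ (j - 1)) * ee ((n : ℤ) - j) := by
  induction n generalizing j with
  | zero =>
    rcases j with _ | j
    · simp [ee, eN]
    · have : ¬ (0 ≤ (0 : ℤ) - (j + 1 : ℕ)) := by omega
      rw [ee, Nat.cast_zero, if_neg this]
      simp [eN, Polynomial.coeff_one]
  | succ n ih =>
    rw [Tq_eN_succ]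
    rcases j with _ | j
    · have : (0 : ℤ) ≤ (n : ℤ) + 1 := by omega
      have h2 : ((n : ℤ) + 1).toNat = n + 1 := by omega
      simp [ee, mul_assoc, this, h2]
    · simp only [mul_assoc, Polynomial.coeff_neg, Polynomial.coeff_add, Polynomial.coeff_C_mul,
        Polynomial.coeff_X_mul, Polynomial.coeff_C_succ, ih]
      rcases j with _ | j
      · simp [ee]; ring
      · simp [pow_succ]; ring

theorem coeff_Tq_hh (m : ℤ) (j : ℕ) :
    (Tq (hh m)).coeff j = (if j = 0 then 1 else 1 - C q) * hh (m - j) := by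
  by_cases h : 0 ≤ m
  · lift m to ℕ using h
    simpa [hh] using coeff_Tq_hN m j
  · have h2 : ¬ (0 ≤ m - j) := by omega
    rw [hh, if_neg h, hh, if_neg h2]; simp

theorem coeff_Tq_ee (m : ℤ) (j : ℕ) :
    (Tq (ee m)).coeff j =
      (if j = 0 then 1 else (1 - C q) * (-C q) ^ (j - 1)) * ee (m - j) := by
  by_cases h : 0 ≤ m
  · lift m to ℕ using h
    simpa [ee] using coeff_Tq_eN m j
  · have h2 : ¬ (0 ≤ m - j) := by omega
    rw [ee, if_neg h, ee, if_neg h2]; simp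

theorem coeff_coeff_swap {R : Type*} [CommSemiring R] (p : Polynomial (Polynomial R)) (r s : ℕ) :
    ((Polynomial.Bivariate.swap p).coeff r).coeff s = (p.coeff s).coeff r := by
  induction p using Polynomial.induction_on' with
  | add p p' h h' => simp [h, h']
  | monomial n f =>
    induction f using Polynomial.induction_on' with
    | add p p' h h' => simp [h, h']
    | monomial k a =>
      rw [Polynomial.Bivariate.swap_monomial_monomial]
      simp only [Polynomial.coeff_monomial]
      split_ifs <;> simp [Polynomial.coeff_monomial, *]

theorem swap_one_sub_C_C_pow {R : Type*} [CommRing R] (c : R) (k : ℕ) :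
    Polynomial.Bivariate.swap (1 - Polynomial.C (Polynomial.C c) ^ k) =
      1 - Polynomial.C (Polynomial.C c) ^ k := by
  simp only [map_sub, map_one, map_pow, Polynomial.Bivariate.swap_C_C]

/-- The operators `h_r[X(1-q)]^⊥` commute with one another. -/
theorem Dq_comm (r s : ℕ) (P : SymF) : Dq r (Dq s P) = Dq s (Dq r P) := by
  let φ : SymF →ₐ[F] Polynomial (Polynomial SymF) := (Polynomial.mapAlgHom Tq).comp Tq
  have h : ((Polynomial.Bivariate.swap (R := SymF)).toAlgHom.restrictScalars F).comp φ = φ := by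
    ext1 k
    simp [φ, Tq, Polynomial.Bivariate.swap_X, Polynomial.Bivariate.swap_Y,
      Polynomial.Bivariate.swap_C_C]
    have hs : Polynomial.Bivariate.swap (1 - Polynomial.C (Polynomial.C (C q : SymF)) ^ (k + 1)) =
        1 - Polynomial.C (Polynomial.C (C q : SymF)) ^ (k + 1) :=
      swap_one_sub_C_C_pow _ _
    rw [hs]
    ring
  have hφ (a b : ℕ) : Dq a (Dq b P) = ((φ P).coeff b).coeff a := by simp [φ, Dq]
  rw [hφ, hφ, ← coeff_coeff_swap]
  exact congr(((($h) P).coeff r).coeff s)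

/-- The linear functional on polynomials in `z` sending `z^r` to `g r`. -/
noncomputable def pairing {R : Type*} [CommRing R] (g : ℕ → R) : Polynomial R →ₗ[R] R :=
  Polynomial.lsum fun r => LinearMap.mulLeft R (g r)

theorem pairing_eq_sum {R : Type*} [CommRing R] (g : ℕ → R) (p : Polynomial R) {K : ℕ}
    (hK : p.natDegree < K) : pairing g p = ∑ r ∈ range K, g r * p.coeff r := by
  simpa [pairing, Polynomial.lsum_apply] using
    p.sum_over_range' (f := fun r a => g r * a) (by simp) _ hK

theorem pairing_monomial {R : Type*} [CommRing R] (g : ℕ → R) (n : ℕ) (a : R) :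
    pairing g (Polynomial.monomial n a) = g n * a := by
  simp [pairing, Polynomial.lsum_apply]

theorem pairing_mul {R : Type*} [CommRing R] (g : ℕ → R) (a b : Polynomial R) {J K : ℕ}
    (hJ : a.natDegree < J) (hK : b.natDegree < K) :
    pairing g (a * b) =
      ∑ s ∈ range K, (∑ j ∈ range J, g (j + s) * a.coeff j) * b.coeff s := by
  conv_lhs => rw [a.as_sum_range' J hJ, b.as_sum_range' K hK]
  simp only [sum_mul_sum, Polynomial.monomial_mul_monomial, map_sum, pairing_monomial]
  rw [sum_comm]
  simp only [sum_mul, mul_assoc]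

theorem Bop_eq_pairing (n : ℤ) (P : SymF) :
    Bop n P = pairing (fun r => C ((-1) ^ r) * ee (n + r)) (Tq P) := by
  rw [pairing_eq_sum _ _ (Nat.lt_succ_self _), Bop]
  simp only [Dq, smul_eq_C_mul, mul_assoc]

theorem Cop_eq_pairing (m : ℤ) (P : SymF) :
    Cop m P = C ((-q⁻¹) ^ (m - 1)) *
      pairing (fun r => C (q⁻¹ ^ r) * hh (m + r)) (Tq P) := by
  rw [pairing_eq_sum _ _ (Nat.lt_succ_self _), Cop]
  simp only [Dq, smul_eq_C_mul, mul_assoc]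

theorem Tq_C (c : F) : Tq (C c) = Polynomial.C (C c) :=
  Tq.commutes c

theorem pairing_Tq_C_mul (g : ℕ → SymF) (c : F) (Q : SymF) :
    pairing g (Tq (C c * Q)) = C c * pairing g (Tq Q) := by
  rw [map_mul, Tq_C, ← Polynomial.smul_eq_C_mul, map_smul, smul_eq_mul]

theorem pairing_Tq_sum (g f : ℕ → SymF) (c : ℕ → F) (P : SymF) {J K : ℕ}
    (hJ : ∀ r < K, (Tq (f r)).natDegree < J) (hK : ∀ r, (Tq (Dq r P)).natDegree < K) :
    pairing g (Tq (∑ r ∈ range K, C (c r) * f r * Dq r P)) =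
      ∑ r ∈ range K, ∑ s ∈ range K,
        C (c r) * (∑ j ∈ range J, g (j + s) * (Tq (f r)).coeff j) * Dq s (Dq r P) := by
  rw [map_sum, map_sum]
  refine sum_congr rfl fun r hr => ?_
  rw [mul_assoc, pairing_Tq_C_mul, map_mul, pairing_mul g _ _ (hJ r (mem_range.mp hr)) (hK r),
    mul_sum]
  simp only [mul_assoc, Dq]

theorem exists_natDegree_Tq_Dq_lt (P : SymF) :
    ∃ K, (Tq P).natDegree < K ∧ ∀ r, (Tq (Dq r P)).natDegree < K := by
  refine ⟨(Tq P).natDegree +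
    (range ((Tq P).natDegree + 1)).sup (fun r => (Tq (Dq r P)).natDegree) + 1,
    by omega, fun r => ?_⟩
  by_cases hr : r < (Tq P).natDegree + 1
  · have : (Tq (Dq r P)).natDegree ≤
        (range ((Tq P).natDegree + 1)).sup fun r => (Tq (Dq r P)).natDegree :=
      le_sup (f := fun r => (Tq (Dq r P)).natDegree) (mem_range.mpr hr)
    omega
  · rw [Dq, Polynomial.coeff_eq_zero_of_natDegree_lt (by omega)]
    simp

theorem natDegree_Tq_hh_le (m : ℤ) : (Tq (hh m)).natDegree ≤ m.natAbs := by
  rw [Polynomial.natDegree_le_iff_coeff_eq_zero]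
  intro j hj
  have hneg : ¬ 0 ≤ m - j := by omega
  rw [coeff_Tq_hh, hh, if_neg hneg, mul_zero]

theorem natDegree_Tq_ee_le (m : ℤ) : (Tq (ee m)).natDegree ≤ m.natAbs := by
  rw [Polynomial.natDegree_le_iff_coeff_eq_zero]
  intro j hj
  have hneg : ¬ 0 ≤ m - j := by omega
  rw [coeff_Tq_ee, ee, if_neg hneg, mul_zero]

theorem sum_neg_one_pow_mul_eN_mul_hN {k : ℕ} (hk : k ≠ 0) :
    ∑ i ∈ range (k + 1), (-1) ^ i * eN i * hN (k - i) = 0 := by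
  have h := congr(PowerSeries.coeff k $hSeries_mul_eSeries)
  rw [mul_comm, PowerSeries.coeff_mul, PowerSeries.coeff_one, if_neg hk] at h
  simp only [hSeries, eSeries, PowerSeries.coeff_mk] at h
  rwa [Finset.Nat.sum_antidiagonal_eq_sum_range_succ
    (fun i j => (-1) ^ i * eN i * hN j)] at h

theorem sum_Ioo_neg_one_zpow (M N : ℤ) (hMN : 0 < M + N) (J : ℕ) (hM : |M| < J) (hN' : |N| < J) :
    ∑ j ∈ Ioo (-(J : ℤ)) J, (j.negOnePow : ℤ) • (ee (N + j) * hh (M - j)) = 0 := by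
  rw [abs_lt] at hM hN'
  obtain ⟨k, hk⟩ := Int.eq_ofNat_of_zero_le hMN.le
  have hsub : Icc (-N) M ⊆ Ioo (-(J : ℤ)) J := fun x hx => by
    simp only [mem_Icc, mem_Ioo] at hx ⊢; omega
  rw [← sum_subset hsub]
  · have h := sum_neg_one_pow_mul_eN_mul_hN (k := k) (by omega)
    have h2 : ∑ j ∈ Icc (-N) M, (j.negOnePow : ℤ) • (ee (N + j) * hh (M - j)) =
        ∑ i ∈ range (k + 1), ((-N).negOnePow : ℤ) • ((-1) ^ i * eN i * hN (k - i)) := by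
      symm
      refine sum_bij (fun i _ => (i : ℤ) - N) ?_ ?_ ?_ ?_
      · intro i hi
        simp only [mem_range, mem_Icc] at hi ⊢; omega
      · intro i _ j _ hij; omega
      · intro j hj
        simp only [mem_Icc] at hj
        exact ⟨(j + N).toNat, by simp only [mem_range]; omega, by omega⟩
      · intro i hi
        simp only [mem_range] at hi
        have h1 : ee (N + ((i : ℤ) - N)) = eN i := by
          rw [ee, if_pos (by omega)]; congr 1; omega
        have h2 : hh (M - ((i : ℤ) - N)) = hN (k - i) := by
          rw [hh, if_pos (by omega)]; congr 1; omega
        rw [h1, h2, sub_eq_add_neg, add_comm, Int.negOnePow_add]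
        simp [mul_assoc]
    rw [h2, ← smul_sum, h, smul_zero]
  · intro x _ hx
    simp only [mem_Icc, not_and_or, not_le] at hx
    rcases hx with hx | hx
    · simp [ee, show ¬ 0 ≤ N + x by omega]
    · simp [hh, show ¬ x ≤ M by omega]

theorem sum_Ioo_neg_eq {A : Type*} [AddCommGroup A] (f : ℤ → A) (J : ℕ) :
    ∑ j ∈ Ioo (-((J + 1 : ℕ) : ℤ)) (J + 1 : ℕ), f j =
      f 0 + ∑ j ∈ range J, f (j + 1) + ∑ j ∈ range J, f (-(j + 1)) := by
  induction J with
  | zero =>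
    have : Ioo (-((0 + 1 : ℕ) : ℤ)) (0 + 1 : ℕ) = {0} := by decide
    rw [this]; simp
  | succ J ih =>
    have : Ioo (-((J + 1 + 1 : ℕ) : ℤ)) (J + 1 + 1 : ℕ) =
        insert ((J : ℤ) + 1) (insert (-((J : ℤ) + 1)) (Ioo (-((J + 1 : ℕ) : ℤ)) (J + 1 : ℕ))) := by
      ext x; simp only [mem_Ioo, mem_insert]; omega
    rw [this, sum_insert, sum_insert, ih, sum_range_succ, sum_range_succ]
    · abel
    · simp
    · simp only [mem_insert, mem_Ioo]; omega

/-- The contribution of a fixed pair of skewing operators to `𝔹 ℂ` and to `q ℂ 𝔹`. -/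
theorem sum_coeff_Tq_hh_eq (M N : ℤ) (hMN : 0 < M + N) (J : ℕ) (hM : |M| < (J + 1 : ℕ))
    (hN' : |N| < (J + 1 : ℕ)) :
    ∑ j ∈ range (J + 1), (-1) ^ j * ee (N + j) * (Tq (hh M)).coeff j =
      C q * ∑ j ∈ range (J + 1), C q⁻¹ ^ j * hh (M + j) * (Tq (ee N)).coeff j := by
  have h := sum_Ioo_neg_one_zpow M N hMN _ hM hN'
  rw [sum_Ioo_neg_eq] at h
  have hq : (C q : SymF) * C q⁻¹ = 1 := by
    rw [← C_mul, mul_inv_cancel₀ q_ne_zero, C_1]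
  have hl : ∑ j ∈ range J, (-1) ^ (j + 1) * ee (N + (j + 1 : ℕ)) * (Tq (hh M)).coeff (j + 1) =
      (1 - C q) * ∑ j ∈ range J,
        (((j : ℤ) + 1).negOnePow : ℤ) • (ee (N + (j + 1)) * hh (M - (j + 1))) := by
    rw [mul_sum]
    refine sum_congr rfl fun j _ => ?_
    rw [coeff_Tq_hh, Int.negOnePow_succ]
    simp [pow_succ]
    ring
  have hr : C q * ∑ j ∈ range J, C q⁻¹ ^ (j + 1) * hh (M + (j + 1 : ℕ)) *
        (Tq (ee N)).coeff (j + 1) =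
      -(1 - C q) * ∑ j ∈ range J,
        ((-((j : ℤ) + 1)).negOnePow : ℤ) • (ee (N + -(j + 1)) * hh (M - -(j + 1))) := by
    rw [mul_sum, mul_sum]
    refine sum_congr rfl fun j _ => ?_
    have hqj : (C q : SymF) ^ (j + 1) * C q⁻¹ ^ (j + 1) = 1 := by rw [← mul_pow, hq, one_pow]
    rw [coeff_Tq_ee, Int.negOnePow_neg, Int.negOnePow_succ]
    have h1 : N - ((j + 1 : ℕ) : ℤ) = N + -((j : ℤ) + 1) := by push_cast; ring
    have h2 : M + ((j + 1 : ℕ) : ℤ) = M - -((j : ℤ) + 1) := by push_cast; ring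
    rw [h1, h2]
    generalize ee (N + -((j : ℤ) + 1)) = e
    generalize hh (M - -((j : ℤ) + 1)) = h
    simp [neg_pow (C q : SymF) j]
    linear_combination (1 - C q) * (-1) ^ j * e * h * hqj
  rw [sum_range_succ', sum_range_succ', mul_add, hl, hr, coeff_Tq_hh, coeff_Tq_ee]
  simp only [Int.negOnePow_zero, Units.val_one, one_smul, add_zero, sub_zero] at h
  simp only [pow_zero, Nat.cast_zero, add_zero, sub_zero, if_true, one_mul]
  linear_combination (1 - C q) * h

theorem sum_shift_eq (m n : ℤ) (hmn : 0 < m + n) (r s J : ℕ)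
    (hJ : m.natAbs + n.natAbs + r + s ≤ J) :
    C (q⁻¹ ^ r) * (∑ j ∈ range (J + 1),
        (C ((-1) ^ (j + s)) * ee (n + (j + s : ℕ))) * (Tq (hh (m + r))).coeff j) =
      C q * (C ((-1) ^ s) * ∑ j ∈ range (J + 1),
        (C (q⁻¹ ^ (j + r)) * hh (m + (j + r : ℕ))) * (Tq (ee (n + s))).coeff j) := by
  have h := sum_coeff_Tq_hh_eq (m + r) (n + s) (by omega) J
    (by rw [abs_lt]; omega) (by rw [abs_lt]; omega)
  have hB : ∑ j ∈ range (J + 1),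
        (C ((-1) ^ (j + s)) * ee (n + (j + s : ℕ))) * (Tq (hh (m + r))).coeff j =
      (-1) ^ s * ∑ j ∈ range (J + 1), (-1) ^ j * ee (n + s + j) * (Tq (hh (m + r))).coeff j := by
    rw [mul_sum]
    refine sum_congr rfl fun j _ => ?_
    rw [show n + ((j + s : ℕ) : ℤ) = n + s + j by push_cast; ring]
    simp only [pow_add, map_mul, map_pow, map_neg, map_one]
    ring
  have hC : ∑ j ∈ range (J + 1),
        (C (q⁻¹ ^ (j + r)) * hh (m + (j + r : ℕ))) * (Tq (ee (n + s))).coeff j =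
      C q⁻¹ ^ r * ∑ j ∈ range (J + 1),
        C q⁻¹ ^ j * hh (m + r + j) * (Tq (ee (n + s))).coeff j := by
    rw [mul_sum]
    refine sum_congr rfl fun j _ => ?_
    rw [show m + ((j + r : ℕ) : ℤ) = m + r + j by push_cast; ring]
    simp only [pow_add, map_mul, map_pow]
    ring
  rw [hB, hC, h]
  simp only [map_pow, map_neg, map_one]
  ring

end HallLittlewood

/-- if `m + n > 0` then `𝔹_n ℂ_m = q ℂ_m 𝔹_n`. -/
theorem stmt15 (m n : ℤ) (hmn : 0 < m + n) (P : SymF) :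
    Bop n (Cop m P) = q • Cop m (Bop n P) := by
  open HallLittlewood in
  obtain ⟨K, hP, hK⟩ := exists_natDegree_Tq_Dq_lt P
  set J := m.natAbs + n.natAbs + K + K
  rw [Cop_eq_pairing m P, Bop_eq_pairing, Bop_eq_pairing n P, Cop_eq_pairing,
    pairing_Tq_C_mul, pairing_eq_sum _ (Tq P) hP, pairing_eq_sum _ (Tq P) hP]
  have hD (r : ℕ) : (Tq P).coeff r = Dq r P := rfl
  simp only [hD]
  rw [pairing_Tq_sum _ (fun r : ℕ => hh (m + r)) (fun r => q⁻¹ ^ r) P (J := J + 1)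
      (fun r hr => (natDegree_Tq_hh_le _).trans_lt (by omega)) hK,
    pairing_Tq_sum _ (fun r : ℕ => ee (n + r)) (fun r => (-1) ^ r) P (J := J + 1)
      (fun r hr => (natDegree_Tq_ee_le _).trans_lt (by omega)) hK,
    smul_eq_C_mul, mul_left_comm (C q), sum_comm]
  congr 1
  rw [mul_sum]
  refine sum_congr rfl fun s hs => ?_
  rw [mul_sum]
  refine sum_congr rfl fun r hr => ?_
  rw [mem_range] at hr hs
  rw [sum_shift_eq m n hmn r s J (by omega), Dq_comm, mul_assoc]
end

section
/- For any composition α of n, B_α[X;q] = Σ_{β ≤ α} q^{doff_α(DP(β))} C_β[X;q], where the sum is over compositions β refining α; consequently, by Möbius-type inversion, C_α[X;q] = Σ_{β ≤ α} (-q)^{ℓ(α)-ℓ(β)} q^{-doff_{rev(α)}(DP(rev(β)))} B_β[X;q]. -/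
open Finset MvPolynomial

section PowerSeriesIdentities

open PowerSeries

/-- The generating series `∑ p_{k+1} t^k` of the power sums. -/
noncomputable def pSeries : PowerSeries SymF := PowerSeries.mk fun k => pp (k + 1)

/-- The generating series of the complete homogeneous symmetric functions. -/
noncomputable def hSeries : PowerSeries SymF := PowerSeries.mk hN

/-- The signed generating series `∑ (-1)^n e_n t^n`. -/
noncomputable def eSeries : PowerSeries SymF := PowerSeries.mk fun n => (-1) ^ n * eN n

theorem succ_mul_hN (n : ℕ) :
    ((n : SymF) + 1) * hN (n + 1) = ∑ k ∈ Finset.range (n + 1), pp (k + 1) * hN (n - k) := by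
  have h0 : (n : F) + 1 ≠ 0 := by exact_mod_cast Nat.succ_ne_zero n
  have hc : ((n : SymF) + 1) = MvPolynomial.C ((n : F) + 1) := by simp
  rw [hN, hc, ← MvPolynomial.smul_eq_C_mul, smul_smul, mul_inv_cancel₀ h0, one_smul]

theorem succ_mul_eN (n : ℕ) :
    ((n : SymF) + 1) * eN (n + 1) =
      ∑ k ∈ Finset.range (n + 1), (-1) ^ k * (pp (k + 1) * eN (n - k)) := by
  have h0 : (n : F) + 1 ≠ 0 := by exact_mod_cast Nat.succ_ne_zero n
  have hc : ((n : SymF) + 1) = MvPolynomial.C ((n : F) + 1) := by simp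
  rw [eN, hc, ← MvPolynomial.smul_eq_C_mul, smul_smul, mul_inv_cancel₀ h0, one_smul]
  simp [MvPolynomial.smul_eq_C_mul]

theorem derivative_hSeries : d⁄dX SymF hSeries = pSeries * hSeries := by
  ext1 n
  rw [PowerSeries.coeff_derivative, PowerSeries.coeff_mul,
    Finset.Nat.sum_antidiagonal_eq_sum_range_succ_mk]
  simp only [hSeries, pSeries, PowerSeries.coeff_mk]
  rw [mul_comm, succ_mul_hN]

theorem derivative_eSeries : d⁄dX SymF eSeries = -(pSeries * eSeries) := by
  ext1 n
  rw [PowerSeries.coeff_derivative, map_neg, PowerSeries.coeff_mul,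
    Finset.Nat.sum_antidiagonal_eq_sum_range_succ_mk]
  simp only [eSeries, pSeries, PowerSeries.coeff_mk]
  rw [mul_comm, mul_left_comm, succ_mul_eN, Finset.mul_sum, ← Finset.sum_neg_distrib]
  refine Finset.sum_congr rfl fun k hk => ?_
  have hk' : k ≤ n := by simpa [Nat.lt_succ_iff] using hk
  have h : ((-1 : SymF) ^ (n + 1)) * (-1) ^ k = -(-1) ^ (n - k) := by
    obtain ⟨d, rfl⟩ := Nat.exists_eq_add_of_le hk'
    rw [Nat.add_sub_cancel_left, ← pow_add, show k + d + 1 + k = 2 * k + (d + 1) by ring, pow_add,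
      pow_mul]
    simp [pow_succ]
  linear_combination (pp (k + 1) * eN (n - k)) * h

theorem eSeries_mul_hSeries : eSeries * hSeries = 1 := by
  refine PowerSeries.derivative.ext ?_ ?_
  · rw [Derivation.leibniz, derivative_hSeries, derivative_eSeries, PowerSeries.derivative_one]
    simp only [smul_eq_mul]
    ring
  · simp [eSeries, hSeries, hN, eN]

theorem sum_neg_one_pow_mul_eN_mul_hN {n : ℕ} (hn : 0 < n) :
    ∑ j ∈ Finset.range (n + 1), (-1) ^ j * (eN j * hN (n - j)) = 0 := by
  have h := congrArg (PowerSeries.coeff n) eSeries_mul_hSeries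
  rw [PowerSeries.coeff_mul, Finset.Nat.sum_antidiagonal_eq_sum_range_succ_mk,
    PowerSeries.coeff_one, if_neg hn.ne'] at h
  simpa [eSeries, hSeries, mul_assoc] using h

theorem constantCoeff_map_apply {R S : Type*} [CommRing R] [CommRing S] (f : R →+* S)
    (g : PowerSeries R) :
    PowerSeries.constantCoeff (PowerSeries.map f g) = f (PowerSeries.constantCoeff g) := by
  rw [← PowerSeries.coeff_zero_eq_constantCoeff_apply, PowerSeries.coeff_map,
    PowerSeries.coeff_zero_eq_constantCoeff_apply]

theorem derivative_mul {R : Type*} [CommRing R] (f g : PowerSeries R) :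
    d⁄dX R (f * g) = f * d⁄dX R g + g * d⁄dX R f := by
  rw [Derivation.leibniz, smul_eq_mul, smul_eq_mul]

theorem derivative_one_sub_C_mul_X {R : Type*} [CommRing R] (a : R) :
    d⁄dX R (1 - PowerSeries.C a * PowerSeries.X) = -PowerSeries.C a := by
  rw [map_sub, Derivation.leibniz, Derivation.map_one_eq_zero, PowerSeries.derivative_C,
    PowerSeries.derivative_X]
  simp

theorem map_derivative {R S : Type*} [CommRing R] [CommRing S] (f : R →+* S) (g : PowerSeries R) :
    d⁄dX S (PowerSeries.map f g) = PowerSeries.map f (d⁄dX R g) := by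
  ext n
  simp [PowerSeries.coeff_derivative]

theorem one_sub_C_mul_X_mul_mk_pow {R : Type*} [CommRing R] (a : R) :
    (1 - PowerSeries.C a * PowerSeries.X) * PowerSeries.mk (fun n => a ^ n) = 1 := by
  ext n
  cases n with
  | zero => simp
  | succ n =>
    rw [sub_mul, one_mul, mul_assoc, map_sub, PowerSeries.coeff_C_mul,
      PowerSeries.coeff_succ_X_mul]
    simp [PowerSeries.coeff_one, pow_succ']

/-- The image of `∑ h_n t^n` under the translation `Tq`, cleared of denominators. -/
theorem map_Tq_hSeries :
    (1 - PowerSeries.C (Polynomial.X : Polynomial SymF) * PowerSeries.X) *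
        PowerSeries.map (Tq : SymF →+* Polynomial SymF) hSeries =
      (1 - PowerSeries.C (Polynomial.C (MvPolynomial.C q) * Polynomial.X) * PowerSeries.X) *
        PowerSeries.map Polynomial.C hSeries := by
  set z : Polynomial SymF := Polynomial.X with hz
  set y : Polynomial SymF := Polynomial.C (MvPolynomial.C q) * Polynomial.X with hy
  set G₁ : PowerSeries (Polynomial SymF) := PowerSeries.mk (fun n => z ^ n) with hG₁
  set G₂ : PowerSeries (Polynomial SymF) := PowerSeries.mk (fun n => y ^ n) with hG₂
  have h₁ := one_sub_C_mul_X_mul_mk_pow z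
  have h₂ := one_sub_C_mul_X_mul_mk_pow y
  rw [← hG₁] at h₁
  rw [← hG₂] at h₂
  set t : PowerSeries (Polynomial SymF) := PowerSeries.X with ht
  set H := PowerSeries.map (Polynomial.C : SymF →+* Polynomial SymF) hSeries with hH
  set H' := PowerSeries.map (Tq : SymF →+* Polynomial SymF) hSeries with hH'
  set E' := PowerSeries.map (Tq : SymF →+* Polynomial SymF) eSeries with hE'
  set p := PowerSeries.map (Polynomial.C : SymF →+* Polynomial SymF) pSeries with hp
  set p' := PowerSeries.map (Tq : SymF →+* Polynomial SymF) pSeries with hp'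
  have hEH : E' * H' = 1 := by rw [hE', hH', ← map_mul, eSeries_mul_hSeries, map_one]
  have dH : d⁄dX _ H = p * H := by rw [hH, map_derivative, derivative_hSeries, map_mul]
  have dE : d⁄dX _ E' = -(p' * E') := by
    rw [hE', map_derivative, derivative_eSeries, map_neg, map_mul]
  have hpp : p' = p + PowerSeries.C z * G₁ - PowerSeries.C y * G₂ := by
    ext1 k
    simp only [hp', hp, hG₁, hG₂, pSeries, pp, map_add, map_sub, PowerSeries.coeff_map,
      PowerSeries.coeff_mk, PowerSeries.coeff_C_mul, Nat.add_sub_cancel]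
    simp only [Tq, RingHom.coe_coe, MvPolynomial.aeval_X, hz, hy]
    simp only [map_sub, map_one, map_pow]
    ring
  have dG : (1 - PowerSeries.C z * t) * d⁄dX _ G₁ = PowerSeries.C z * G₁ := by
    have h := congrArg (d⁄dX (Polynomial SymF)) h₁
    rw [derivative_mul, derivative_one_sub_C_mul_X, PowerSeries.derivative_one] at h
    linear_combination h
  have dG' : d⁄dX _ G₁ = PowerSeries.C z * G₁ ^ 2 := by
    linear_combination G₁ * dG - (d⁄dX _ G₁) * h₁
  have hV : (1 - PowerSeries.C y * t) * (H * (E' * G₁)) = 1 := by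
    refine PowerSeries.derivative.ext ?_ ?_
    · rw [derivative_mul, derivative_one_sub_C_mul_X, derivative_mul, derivative_mul,
        PowerSeries.derivative_one, dH, dE, dG', hpp]
      linear_combination (PowerSeries.C y * H * E' * G₁) * h₂
    · simp [hH, hE', hG₁, ht, constantCoeff_map_apply, eSeries, hSeries, hN, eN]
  linear_combination (-(1 - PowerSeries.C z * t) * H') * hV +
    ((1 - PowerSeries.C y * t) * H * G₁ * (1 - PowerSeries.C z * t)) * hEH +
    ((1 - PowerSeries.C y * t) * H) * h₁

theorem map_Tq_eSeries :
    (1 - PowerSeries.C (Polynomial.C (MvPolynomial.C q) * Polynomial.X) * PowerSeries.X) *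
        PowerSeries.map (Tq : SymF →+* Polynomial SymF) eSeries =
      (1 - PowerSeries.C (Polynomial.X : Polynomial SymF) * PowerSeries.X) *
        PowerSeries.map Polynomial.C eSeries := by
  have h₁ : PowerSeries.map (Tq : SymF →+* Polynomial SymF) eSeries *
      PowerSeries.map (Tq : SymF →+* Polynomial SymF) hSeries = 1 := by
    rw [← map_mul, eSeries_mul_hSeries, map_one]
  have h₂ : PowerSeries.map (Polynomial.C : SymF →+* Polynomial SymF) eSeries *
      PowerSeries.map (Polynomial.C : SymF →+* Polynomial SymF) hSeries = 1 := by
    rw [← map_mul, eSeries_mul_hSeries, map_one]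
  have h := map_Tq_hSeries
  generalize PowerSeries.map (Tq : SymF →+* Polynomial SymF) eSeries = E' at *
  generalize PowerSeries.map (Tq : SymF →+* Polynomial SymF) hSeries = H' at *
  generalize PowerSeries.map (Polynomial.C : SymF →+* Polynomial SymF) eSeries = E at *
  generalize PowerSeries.map (Polynomial.C : SymF →+* Polynomial SymF) hSeries = H at *
  generalize (1 - PowerSeries.C (Polynomial.C (MvPolynomial.C q) * Polynomial.X) *
    PowerSeries.X : PowerSeries (Polynomial SymF)) = v at *
  generalize (1 - PowerSeries.C (Polynomial.X : Polynomial SymF) * PowerSeries.X) = u at *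
  linear_combination (-E * E') * h + (E * u) * h₁ - (E' * v) * h₂

theorem Tq_hN_succ (n : ℕ) :
    Tq (hN (n + 1)) = Polynomial.X * Tq (hN n) + Polynomial.C (hN (n + 1)) -
      Polynomial.C (MvPolynomial.C q * hN n) * Polynomial.X := by
  have h := congrArg (PowerSeries.coeff (n + 1)) map_Tq_hSeries
  simp only [sub_mul, one_mul, mul_assoc, map_sub, PowerSeries.coeff_C_mul,
      PowerSeries.coeff_succ_X_mul, PowerSeries.coeff_map, hSeries, PowerSeries.coeff_mk,
      RingHom.coe_coe] at h
  rw [map_mul]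
  linear_combination h

theorem Tq_eN_succ (n : ℕ) :
    Tq (eN (n + 1)) = -(Polynomial.C (MvPolynomial.C q) * Polynomial.X * Tq (eN n)) +
      Polynomial.C (eN (n + 1)) + Polynomial.C (eN n) * Polynomial.X := by
  have h := congrArg (PowerSeries.coeff (n + 1)) map_Tq_eSeries
  simp only [sub_mul, one_mul, mul_assoc, map_sub, PowerSeries.coeff_C_mul,
      PowerSeries.coeff_succ_X_mul, PowerSeries.coeff_map, eSeries, PowerSeries.coeff_mk,
      RingHom.coe_coe, map_mul, map_pow, map_neg, map_one] at h
  have hs : ((-1 : Polynomial SymF) ^ n) * (-1) ^ n = 1 := pow_mul_pow_eq_one n (by ring)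
  rw [pow_succ] at h
  linear_combination (-(-1 : Polynomial SymF) ^ n) * h + (-Tq (eN (n + 1)) -
    (Polynomial.C (MvPolynomial.C q) * Polynomial.X * Tq (eN n)) +
      Polynomial.C (eN (n + 1)) + Polynomial.C (eN n) * Polynomial.X) * hs

/-- The value of `h_s` at the alphabet `1 - q`. -/
noncomputable def hCoeff (s : ℕ) : F := if s = 0 then 1 else 1 - q

/-- The value of `e_s` at the alphabet `1 - q`. -/
noncomputable def eCoeff (s : ℕ) : F := if s = 0 then 1 else (-q) ^ (s - 1) * (1 - q)

theorem Tq_hN (n : ℕ) :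
    Tq (hN n) = ∑ s ∈ Finset.range (n + 1),
      Polynomial.C (MvPolynomial.C (hCoeff s) * hN (n - s)) * Polynomial.X ^ s := by
  induction n with
  | zero => simp [hN, hCoeff]
  | succ n ih =>
    rw [Tq_hN_succ, ih, Finset.sum_range_succ' _ (n + 1), Finset.sum_range_succ' _ n,
      Finset.sum_range_succ' _ n, mul_add, Finset.mul_sum]
    have h : ∀ s ∈ Finset.range n, (Polynomial.X : Polynomial SymF) *
        (Polynomial.C (MvPolynomial.C (hCoeff (s + 1)) * hN (n - (s + 1))) *
          Polynomial.X ^ (s + 1)) =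
        Polynomial.C (MvPolynomial.C (hCoeff (s + 1 + 1)) * hN (n + 1 - (s + 1 + 1))) *
          Polynomial.X ^ (s + 1 + 1) := by
      intro s _
      rw [Nat.add_sub_add_right]
      simp only [hCoeff, Nat.succ_ne_zero, if_false]
      ring
    rw [Finset.sum_congr rfl h]
    simp [hCoeff]
    ring

theorem Tq_eN (n : ℕ) :
    Tq (eN n) = ∑ s ∈ Finset.range (n + 1),
      Polynomial.C (MvPolynomial.C (eCoeff s) * eN (n - s)) * Polynomial.X ^ s := by
  induction n with
  | zero => simp [eN, eCoeff]
  | succ n ih =>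
    rw [Tq_eN_succ, ih, Finset.sum_range_succ' _ (n + 1), Finset.sum_range_succ' _ n,
      Finset.sum_range_succ' _ n, mul_add, Finset.mul_sum, neg_add, ← Finset.sum_neg_distrib]
    have h : ∀ s ∈ Finset.range n, -(Polynomial.C (MvPolynomial.C q) * Polynomial.X *
        (Polynomial.C (MvPolynomial.C (eCoeff (s + 1)) * eN (n - (s + 1))) *
          Polynomial.X ^ (s + 1))) =
        Polynomial.C (MvPolynomial.C (eCoeff (s + 1 + 1)) * eN (n + 1 - (s + 1 + 1))) *
          Polynomial.X ^ (s + 1 + 1) := by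
      intro s _
      rw [Nat.add_sub_add_right]
      simp only [eCoeff, Nat.succ_ne_zero, if_false, Nat.add_sub_cancel, pow_succ, map_mul,
        map_neg]
      ring
    rw [Finset.sum_congr rfl h]
    simp [eCoeff]
    ring

end PowerSeriesIdentities

theorem q_ne_zero : q ≠ 0 := RatFunc.X_ne_zero

section Operators

/-- The `R`-linear functional on polynomials sending `z ^ i` to `w i`. -/
noncomputable def weightSum {R : Type*} [CommRing R] (w : ℕ → R) : Polynomial R →ₗ[R] R :=
  Polynomial.lsum fun i => LinearMap.mulRight R (w i)

theorem weightSum_C_mul_X_pow {R : Type*} [CommRing R] (w : ℕ → R) (c : R) (i : ℕ) :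
    weightSum w (Polynomial.C c * Polynomial.X ^ i) = c * w i := by
  rw [Polynomial.C_mul_X_pow_eq_monomial, weightSum, Polynomial.lsum_apply,
    Polynomial.sum_monomial_index _ _ (by simp)]
  simp

theorem weightSum_mul_monomials {R : Type*} [CommRing R] (w : ℕ → R) (c d : R) (i j : ℕ) :
    weightSum w (Polynomial.C c * Polynomial.X ^ i * (Polynomial.C d * Polynomial.X ^ j)) =
      c * d * w (j + i) := by
  rw [← weightSum_C_mul_X_pow w, Polynomial.C_mul, pow_add]
  congr 1
  ring

theorem weightSum_eq_sum_range {R : Type*} [CommRing R] (w : ℕ → R) {p : Polynomial R} {N : ℕ}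
    (hN : p.natDegree < N) :
    weightSum w p = ∑ i ∈ Finset.range N, p.coeff i * w i := by
  conv_lhs => rw [Polynomial.as_sum_range_C_mul_X_pow' p hN]
  simp [weightSum_C_mul_X_pow]

/-- The operator `P ↦ ∑ r, w r * h_r[X(1-q)]^⊥ P`. -/
noncomputable def creationOp (w : ℕ → SymF) : SymF →ₗ[F] SymF :=
  ((weightSum w).restrictScalars F).comp Tq.toLinearMap

theorem creationOp_apply (w : ℕ → SymF) (P : SymF) : creationOp w P = weightSum w (Tq P) := rfl

theorem creationOp_eq_sum_range (w : ℕ → SymF) {P : SymF} {N : ℕ}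
    (hN : (Tq P).natDegree < N) :
    creationOp w P = ∑ i ∈ Finset.range N, Dq i P * w i :=
  weightSum_eq_sum_range w hN

/-- The weights defining `𝔹_m`. -/
noncomputable def bWeight (m i : ℕ) : SymF := MvPolynomial.C ((-1) ^ i) * eN (m + i)

/-- The weights defining `ℂ_m`, up to the factor `(-1/q)^(m-1)`. -/
noncomputable def cWeight (m i : ℕ) : SymF := MvPolynomial.C (q⁻¹ ^ i) * hN (m + i)

theorem Bop_eq_creationOp (m : ℕ) (P : SymF) : Bop m P = creationOp (bWeight m) P := by
  rw [creationOp_eq_sum_range _ (Nat.lt_succ_self _), Bop]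
  refine Finset.sum_congr rfl fun r _ => ?_
  have h : ee ((m : ℤ) + r) = eN (m + r) := by
    rw [ee, if_pos (by positivity)]
    congr 1
  rw [h, MvPolynomial.smul_eq_C_mul, bWeight]
  ring

theorem Cop_eq_creationOp (m : ℕ) (P : SymF) :
    Cop m P = ((-q⁻¹ : F) ^ ((m : ℤ) - 1)) • creationOp (cWeight m) P := by
  rw [creationOp_eq_sum_range _ (Nat.lt_succ_self _), Cop]
  congr 1
  refine Finset.sum_congr rfl fun r _ => ?_
  have h : hh ((m : ℤ) + r) = hN (m + r) := by
    rw [hh, if_pos (by positivity)]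
    congr 1
  rw [h, MvPolynomial.smul_eq_C_mul, cWeight]
  ring

theorem creationOp_hN_mul (w : ℕ → SymF) (k : ℕ) {P : SymF} {N : ℕ}
    (h : (Tq P).natDegree < N) :
    creationOp w (hN k * P) = ∑ s ∈ Finset.range (k + 1), ∑ a ∈ Finset.range N,
      MvPolynomial.C (hCoeff s) * hN (k - s) * Dq a P * w (a + s) := by
  rw [creationOp_apply, map_mul, Tq_hN, Polynomial.as_sum_range_C_mul_X_pow' (Tq P) h,
    Finset.sum_mul_sum, map_sum]
  refine Finset.sum_congr rfl fun s _ => ?_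
  rw [map_sum]
  exact Finset.sum_congr rfl fun a _ => weightSum_mul_monomials w _ _ _ _

theorem creationOp_eN_mul (w : ℕ → SymF) (k : ℕ) {P : SymF} {N : ℕ}
    (h : (Tq P).natDegree < N) :
    creationOp w (eN k * P) = ∑ s ∈ Finset.range (k + 1), ∑ a ∈ Finset.range N,
      MvPolynomial.C (eCoeff s) * eN (k - s) * Dq a P * w (a + s) := by
  rw [creationOp_apply, map_mul, Tq_eN, Polynomial.as_sum_range_C_mul_X_pow' (Tq P) h,
    Finset.sum_mul_sum, map_sum]
  refine Finset.sum_congr rfl fun s _ => ?_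
  rw [map_sum]
  exact Finset.sum_congr rfl fun a _ => weightSum_mul_monomials w _ _ _ _

theorem creationOp_hN (w : ℕ → SymF) (k : ℕ) :
    creationOp w (hN k) = ∑ s ∈ Finset.range (k + 1),
      MvPolynomial.C (hCoeff s) * hN (k - s) * w s := by
  rw [creationOp_apply, Tq_hN, map_sum]
  exact Finset.sum_congr rfl fun s _ => weightSum_C_mul_X_pow _ _ _

theorem creationOp_eN (w : ℕ → SymF) (k : ℕ) :
    creationOp w (eN k) = ∑ s ∈ Finset.range (k + 1),
      MvPolynomial.C (eCoeff s) * eN (k - s) * w s := by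
  rw [creationOp_apply, Tq_eN, map_sum]
  exact Finset.sum_congr rfl fun s _ => weightSum_C_mul_X_pow _ _ _

theorem creationOp_one (w : ℕ → SymF) : creationOp w 1 = w 0 := by
  have h := creationOp_hN w 0
  simpa [hN, hCoeff] using h

/-- `h_r[X(1-q)]^⊥` as a linear map. -/
noncomputable def DqLinear (r : ℕ) : SymF →ₗ[F] SymF :=
  ((Polynomial.lcoeff SymF r).restrictScalars F).comp Tq.toLinearMap

theorem DqLinear_apply (r : ℕ) (P : SymF) : DqLinear r P = Dq r P := rfl

theorem Dq_mul_X (r k : ℕ) (P : SymF) :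
    Dq r (P * MvPolynomial.X k) = Dq r P * MvPolynomial.X k +
      if k + 1 ≤ r then (1 - q ^ (k + 1)) • Dq (r - (k + 1)) P else 0 := by
  have h : Tq (P * MvPolynomial.X k) = Tq P * Polynomial.C (MvPolynomial.X k) +
      Polynomial.C (MvPolynomial.C (1 - q ^ (k + 1))) * (Tq P * Polynomial.X ^ (k + 1)) := by
    rw [map_mul]
    conv_lhs => rw [Tq, MvPolynomial.aeval_X, ← Tq]
    ring
  rw [Dq, h, Polynomial.coeff_add, Polynomial.coeff_mul_C, Polynomial.coeff_C_mul,
    Polynomial.coeff_mul_X_pow']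
  split_ifs <;> simp [Dq, MvPolynomial.smul_eq_C_mul]

theorem Dq_comm (i j : ℕ) (P : SymF) : Dq i (Dq j P) = Dq j (Dq i P) := by
  induction P using MvPolynomial.induction_on generalizing i j with
  | C a =>
    have h : ∀ r, Dq r (MvPolynomial.C a) = if r = 0 then MvPolynomial.C a else 0 := by
      intro r
      have h' : Tq (MvPolynomial.C a) = Polynomial.C (MvPolynomial.C a) := by
        rw [Tq, MvPolynomial.aeval_C]
        rfl
      rw [Dq, h', Polynomial.coeff_C]
    have h0 : ∀ r, Dq r 0 = 0 := fun r => (DqLinear r).map_zero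
    by_cases hi : i = 0 <;> by_cases hj : j = 0 <;> simp [h, h0, hi, hj]
  | add p p' hp hp' =>
    simp only [← DqLinear_apply, map_add] at *
    rw [hp, hp']
  | mul_X p k hp =>
    have hadd : ∀ r x y, Dq r (x + y) = Dq r x + Dq r y := fun r => (DqLinear r).map_add
    have hsmul : ∀ r (c : F) x, Dq r (c • x) = c • Dq r x := fun r => (DqLinear r).map_smul
    have h0 : ∀ r, Dq r 0 = 0 := fun r => (DqLinear r).map_zero
    rw [Dq_mul_X, Dq_mul_X, hadd, hadd, Dq_mul_X, Dq_mul_X, hp i j]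
    by_cases hi : k + 1 ≤ i <;> by_cases hj : k + 1 ≤ j <;>
      simp only [hi, hj, if_true, if_false, h0, hsmul, add_zero]
    · rw [hp (i - (k + 1)) j, hp i (j - (k + 1))]
      abel
    · rw [hp (i - (k + 1)) j]
    · rw [hp i (j - (k + 1))]

theorem natDegree_Tq_Dq_le (j : ℕ) (P : SymF) :
    (Tq (Dq j P)).natDegree ≤ (Tq P).natDegree := by
  refine Polynomial.natDegree_le_iff_coeff_eq_zero.mpr fun i hi => ?_
  change Dq i (Dq j P) = 0
  rw [Dq_comm, show Dq i P = 0 from Polynomial.coeff_eq_zero_of_natDegree_lt hi]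
  exact (DqLinear j).map_zero

theorem sum_hCoeff_eq_sum_eCoeff {M N : ℕ} (h : 0 < M + N) :
    ∑ s ∈ Finset.range (N + 1),
        MvPolynomial.C (hCoeff s * (-1) ^ s) * (eN (M + s) * hN (N - s)) =
      ∑ t ∈ Finset.range (M + 1),
        MvPolynomial.C (q * eCoeff t * q⁻¹ ^ t) * (eN (M - t) * hN (N + t)) := by
  have hq := q_ne_zero
  have hsum := sum_neg_one_pow_mul_eN_mul_hN h
  rw [add_assoc, Finset.sum_range_add, ← Finset.sum_range_reflect, Finset.sum_range_succ'] at hsum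
  have h₁ : ∀ s ∈ Finset.range N,
      (MvPolynomial.C (hCoeff (s + 1) * (-1) ^ (s + 1)) * (eN (M + (s + 1)) * hN (N - (s + 1)))
        : SymF) =
      MvPolynomial.C ((1 - q) * (-1) ^ M) * ((-1) ^ (M + (s + 1)) *
        (eN (M + (s + 1)) * hN (M + N - (M + (s + 1))))) := by
    intro s _
    have hs : (-1 : SymF) ^ M * (-1) ^ (M + (s + 1)) = (-1) ^ (s + 1) := by
      rw [pow_add, ← mul_assoc, pow_mul_pow_eq_one M (by ring), one_mul]
    rw [Nat.add_sub_add_left, hCoeff, if_neg (Nat.succ_ne_zero s)]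
    simp only [map_mul, map_pow, map_neg, map_one]
    linear_combination (-MvPolynomial.C (1 - q) * (eN (M + (s + 1)) * hN (N - (s + 1)))) * hs
  have h₂ : ∀ t ∈ Finset.range M,
      (MvPolynomial.C (q * eCoeff (t + 1) * q⁻¹ ^ (t + 1)) *
        (eN (M - (t + 1)) * hN (N + (t + 1))) : SymF) =
      -(MvPolynomial.C ((1 - q) * (-1) ^ M) * ((-1) ^ (M - 1 - t) *
        (eN (M - 1 - t) * hN (M + N - (M - 1 - t))))) := by
    intro t ht
    obtain ⟨d, rfl⟩ := Nat.exists_eq_add_of_le (Nat.succ_le_of_lt (Finset.mem_range.mp ht))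
    have e₁ : t.succ + d - (t + 1) = d := by omega
    have e₂ : t.succ + d - 1 - t = d := by omega
    have e₃ : t.succ + d + N - d = N + (t + 1) := by omega
    rw [e₁, e₂, e₃]
    have hs : (-1 : SymF) ^ (t.succ + d) * (-1) ^ d = (-1) ^ (t + 1) := by
      rw [pow_add, mul_assoc, pow_mul_pow_eq_one d (by ring), mul_one]
    have hc : q * eCoeff (t + 1) * q⁻¹ ^ (t + 1) = (1 - q) * (-1) ^ t := by
      rw [eCoeff, if_neg (Nat.succ_ne_zero t), Nat.add_sub_cancel, neg_pow, inv_pow]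
      field_simp
      ring
    rw [hc]
    simp only [map_mul, map_pow, map_neg, map_one]
    rw [pow_succ] at hs
    linear_combination (MvPolynomial.C (1 - q) * (eN d * hN (N + (t + 1)))) * hs
  rw [Finset.sum_range_succ', Finset.sum_range_succ', Finset.sum_congr rfl h₁,
    Finset.sum_congr rfl h₂, ← Finset.mul_sum, Finset.sum_neg_distrib, ← Finset.mul_sum]
  have hs : (-1 : SymF) ^ M * (-1) ^ M = 1 := pow_mul_pow_eq_one M (by ring)
  simp only [hCoeff, eCoeff, if_true, pow_zero, mul_one, map_one, Nat.sub_zero, add_zero, one_mul,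
    Nat.add_sub_cancel_left] at hsum ⊢
  simp only [map_mul, map_sub, map_pow, map_neg, map_one]
  linear_combination ((1 - MvPolynomial.C q) * (-1) ^ M) * hsum -
    ((1 - MvPolynomial.C q) * eN M * hN N) * hs

theorem creationOp_comm {m n : ℕ} (hmn : 0 < m + n) (P : SymF) :
    creationOp (bWeight m) (creationOp (cWeight n) P) =
      q • creationOp (cWeight n) (creationOp (bWeight m) P) := by
  obtain ⟨N, hN'⟩ : ∃ N, (Tq P).natDegree < N := ⟨_, Nat.lt_succ_self _⟩
  have hdeg : ∀ j, (Tq (Dq j P)).natDegree < N := fun j =>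
    (natDegree_Tq_Dq_le j P).trans_lt hN'
  have hC : ∀ j, Dq j P * cWeight n j = (q⁻¹ ^ j) • (hN (n + j) * Dq j P) := by
    intro j
    rw [cWeight, MvPolynomial.smul_eq_C_mul]
    ring
  have hB : ∀ j, Dq j P * bWeight m j = ((-1 : F) ^ j) • (eN (m + j) * Dq j P) := by
    intro j
    rw [bWeight, MvPolynomial.smul_eq_C_mul]
    ring
  rw [creationOp_eq_sum_range (cWeight n) hN', creationOp_eq_sum_range (bWeight m) hN', map_sum,
    map_sum, Finset.smul_sum]
  simp only [hC, hB, map_smul, creationOp_hN_mul _ _ (hdeg _), creationOp_eN_mul _ _ (hdeg _)]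
  have hL : ∀ j ∈ Finset.range N, (q⁻¹ ^ j) • ∑ s ∈ Finset.range (n + j + 1),
      ∑ a ∈ Finset.range N, MvPolynomial.C (hCoeff s) * hN (n + j - s) * Dq a (Dq j P) *
        bWeight m (a + s) =
      ∑ a ∈ Finset.range N, MvPolynomial.C (q⁻¹ ^ j * (-1) ^ a) * Dq a (Dq j P) *
        ∑ s ∈ Finset.range (n + j + 1),
          MvPolynomial.C (hCoeff s * (-1) ^ s) * (eN (m + a + s) * hN (n + j - s)) := by
    intro j _
    rw [Finset.sum_comm, Finset.smul_sum]
    refine Finset.sum_congr rfl fun a _ => ?_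
    rw [Finset.smul_sum, Finset.mul_sum]
    refine Finset.sum_congr rfl fun s _ => ?_
    rw [bWeight, MvPolynomial.smul_eq_C_mul, ← add_assoc, pow_add]
    simp only [map_mul]
    ring
  have hR : ∀ a ∈ Finset.range N, q • ((-1 : F) ^ a) • ∑ t ∈ Finset.range (m + a + 1),
      ∑ j ∈ Finset.range N, MvPolynomial.C (eCoeff t) * eN (m + a - t) * Dq j (Dq a P) *
        cWeight n (j + t) =
      ∑ j ∈ Finset.range N, MvPolynomial.C (q⁻¹ ^ j * (-1) ^ a) * Dq a (Dq j P) *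
        ∑ t ∈ Finset.range (m + a + 1),
          MvPolynomial.C (q * eCoeff t * q⁻¹ ^ t) * (eN (m + a - t) * hN (n + j + t)) := by
    intro a _
    rw [Finset.sum_comm, Finset.smul_sum, Finset.smul_sum]
    refine Finset.sum_congr rfl fun j _ => ?_
    rw [Finset.smul_sum, Finset.smul_sum, Finset.mul_sum]
    refine Finset.sum_congr rfl fun t _ => ?_
    rw [cWeight, MvPolynomial.smul_eq_C_mul, MvPolynomial.smul_eq_C_mul, ← add_assoc, pow_add,
      Dq_comm j a]
    simp only [map_mul]
    ring
  rw [Finset.sum_congr rfl hL, Finset.sum_congr rfl hR, Finset.sum_comm]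
  refine Finset.sum_congr rfl fun a _ => Finset.sum_congr rfl fun j _ => ?_
  rw [sum_hCoeff_eq_sum_eCoeff (by omega)]

theorem Bop_Cop {m n : ℕ} (hmn : 0 < m + n) (P : SymF) :
    Bop m (Cop n P) = q • Cop n (Bop m P) := by
  rw [Bop_eq_creationOp, Cop_eq_creationOp, Cop_eq_creationOp, Bop_eq_creationOp, map_smul,
    creationOp_comm hmn, smul_comm]

theorem Bop_one (m : ℕ) : Bop m 1 = eN m := by
  rw [Bop_eq_creationOp, creationOp_one]
  simp [bWeight]

theorem Cop_one (m : ℕ) : Cop m 1 = ((-q⁻¹ : F) ^ ((m : ℤ) - 1)) • hN m := by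
  rw [Cop_eq_creationOp, creationOp_one]
  simp [cWeight]

theorem sum_eCoeff (s : ℕ) :
    ∑ k ∈ Finset.range (s + 1), (-q⁻¹) ^ k * (eCoeff (s - k) * q⁻¹ ^ (s - k)) = (-1) ^ s := by
  have hq := q_ne_zero
  induction s with
  | zero => simp [eCoeff]
  | succ s ih =>
    rw [Finset.sum_range_succ']
    have h : ∀ k ∈ Finset.range (s + 1), (-q⁻¹) ^ (k + 1) *
        (eCoeff (s + 1 - (k + 1)) * q⁻¹ ^ (s + 1 - (k + 1))) =
        (-q⁻¹) * ((-q⁻¹) ^ k * (eCoeff (s - k) * q⁻¹ ^ (s - k))) := by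
      intro k _
      rw [Nat.add_sub_add_right]
      ring
    rw [Finset.sum_congr rfl h, ← Finset.mul_sum, ih, Nat.sub_zero, eCoeff,
      if_neg (Nat.succ_ne_zero s), Nat.add_sub_cancel, neg_pow q, inv_pow, pow_succ, pow_succ]
    field_simp
    ring

theorem sum_hCoeff (s : ℕ) :
    ∑ k ∈ Finset.range (s + 1), (-q) ^ k * (hCoeff (s - k) * (-1) ^ (s - k)) = (-1) ^ s := by
  induction s with
  | zero => simp [hCoeff]
  | succ s ih =>
    rw [Finset.sum_range_succ']
    have h : ∀ k ∈ Finset.range (s + 1), (-q) ^ (k + 1) *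
        (hCoeff (s + 1 - (k + 1)) * (-1) ^ (s + 1 - (k + 1))) =
        (-q) * ((-q) ^ k * (hCoeff (s - k) * (-1) ^ (s - k))) := by
      intro k _
      rw [Nat.add_sub_add_right]
      ring
    rw [Finset.sum_congr rfl h, ← Finset.mul_sum, ih, Nat.sub_zero, hCoeff,
      if_neg (Nat.succ_ne_zero s)]
    ring

theorem sum_Cop_eN (m : ℕ) :
    ∑ k ∈ Finset.range (m + 1), Cop ((k + 1 : ℕ) : ℤ) (eN (m - k)) = eN (m + 1) := by
  have h : ∀ k ∈ Finset.range (m + 1), Cop ((k + 1 : ℕ) : ℤ) (eN (m - k)) =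
      ∑ r ∈ Finset.range (m + 1 - k), MvPolynomial.C ((-q⁻¹) ^ k * (eCoeff r * q⁻¹ ^ r)) *
        (eN (m - (k + r)) * hN (k + r + 1)) := by
    intro k hk
    have hk' : k ≤ m := Nat.lt_succ_iff.mp (Finset.mem_range.mp hk)
    rw [Cop_eq_creationOp, creationOp_eN, Nat.cast_succ, add_sub_cancel_right, zpow_natCast,
      Finset.smul_sum, Nat.sub_add_comm hk']
    refine Finset.sum_congr rfl fun r _ => ?_
    rw [cWeight, MvPolynomial.smul_eq_C_mul, Nat.sub_sub, add_right_comm]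
    simp only [map_mul]
    ring
  rw [Finset.sum_congr rfl h, ← Finset.sum_range_diag_flip (m + 1) fun k r =>
    MvPolynomial.C ((-q⁻¹) ^ k * (eCoeff r * q⁻¹ ^ r)) * (eN (m - (k + r)) * hN (k + r + 1))]
  have h' : ∀ s ∈ Finset.range (m + 1), ∑ k ∈ Finset.range (s + 1),
      MvPolynomial.C ((-q⁻¹) ^ k * (eCoeff (s - k) * q⁻¹ ^ (s - k))) *
        (eN (m - (k + (s - k))) * hN (k + (s - k) + 1)) =
      (-1) ^ s * (eN (m - s) * hN (s + 1)) := by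
    intro s _
    have h₁ : ((-1) ^ s : SymF) = MvPolynomial.C ((-1) ^ s) := by simp
    rw [h₁, ← sum_eCoeff s, map_sum, Finset.sum_mul]
    refine Finset.sum_congr rfl fun k hk => ?_
    rw [Nat.add_sub_cancel' (Nat.lt_succ_iff.mp (Finset.mem_range.mp hk))]
  rw [Finset.sum_congr rfl h']
  have hsum := sum_neg_one_pow_mul_eN_mul_hN (Nat.succ_pos m)
  rw [← Finset.sum_range_reflect, Finset.sum_range_succ'] at hsum
  have h'' : ∀ s ∈ Finset.range (m + 1), ((-1) ^ (m + 1 + 1 - 1 - (s + 1)) *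
      (eN (m + 1 + 1 - 1 - (s + 1)) * hN (m + 1 - (m + 1 + 1 - 1 - (s + 1)))) : SymF) =
      (-1) ^ m * ((-1) ^ s * (eN (m - s) * hN (s + 1))) := by
    intro s hs
    obtain ⟨d, rfl⟩ := Nat.exists_eq_add_of_le (Nat.lt_succ_iff.mp (Finset.mem_range.mp hs))
    have e₁ : s + d + 1 + 1 - 1 - (s + 1) = d := by omega
    have e₂ : s + d + 1 - d = s + 1 := by omega
    have h₂ : (-1 : SymF) ^ s * (-1) ^ s = 1 := pow_mul_pow_eq_one s (by ring)
    rw [e₁, e₂, Nat.add_sub_cancel_left, pow_add]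
    linear_combination (-(-1) ^ d * (eN d * hN (s + 1))) * h₂
  rw [Nat.succ_eq_add_one, Finset.sum_congr rfl h'', ← Finset.mul_sum] at hsum
  have h₂ : (-1 : SymF) ^ m * (-1) ^ m = 1 := pow_mul_pow_eq_one m (by ring)
  simp only [Nat.add_sub_cancel, Nat.sub_zero, Nat.sub_self] at hsum
  rw [show hN 0 = 1 by rw [hN], pow_succ] at hsum
  linear_combination (-1) ^ m * hsum +
    (eN (m + 1) - ∑ s ∈ Finset.range (m + 1), (-1) ^ s * (eN (m - s) * hN (s + 1))) * h₂

theorem sum_Bop_hN (m : ℕ) :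
    ∑ k ∈ Finset.range (m + 1), ((-q) ^ k) • Bop ((k + 1 : ℕ) : ℤ) (hN (m - k)) = hN (m + 1) := by
  have h : ∀ k ∈ Finset.range (m + 1), ((-q) ^ k) • Bop ((k + 1 : ℕ) : ℤ) (hN (m - k)) =
      ∑ r ∈ Finset.range (m + 1 - k), MvPolynomial.C ((-q) ^ k * (hCoeff r * (-1) ^ r)) *
        (eN (k + r + 1) * hN (m - (k + r))) := by
    intro k hk
    have hk' : k ≤ m := Nat.lt_succ_iff.mp (Finset.mem_range.mp hk)
    rw [Bop_eq_creationOp, creationOp_hN, Finset.smul_sum, Nat.sub_add_comm hk']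
    refine Finset.sum_congr rfl fun r _ => ?_
    rw [bWeight, MvPolynomial.smul_eq_C_mul, Nat.sub_sub, add_right_comm]
    simp only [map_mul]
    ring
  rw [Finset.sum_congr rfl h, ← Finset.sum_range_diag_flip (m + 1) fun k r =>
    MvPolynomial.C ((-q) ^ k * (hCoeff r * (-1) ^ r)) * (eN (k + r + 1) * hN (m - (k + r)))]
  have h' : ∀ s ∈ Finset.range (m + 1), ∑ k ∈ Finset.range (s + 1),
      MvPolynomial.C ((-q) ^ k * (hCoeff (s - k) * (-1) ^ (s - k))) *
        (eN (k + (s - k) + 1) * hN (m - (k + (s - k)))) =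
      (-1) ^ s * (eN (s + 1) * hN (m - s)) := by
    intro s _
    have h₁ : ((-1) ^ s : SymF) = MvPolynomial.C ((-1) ^ s) := by simp
    rw [h₁, ← sum_hCoeff s, map_sum, Finset.sum_mul]
    refine Finset.sum_congr rfl fun k hk => ?_
    rw [Nat.add_sub_cancel' (Nat.lt_succ_iff.mp (Finset.mem_range.mp hk))]
  rw [Finset.sum_congr rfl h']
  have hsum := sum_neg_one_pow_mul_eN_mul_hN (Nat.succ_pos m)
  rw [Nat.succ_eq_add_one, Finset.sum_range_succ'] at hsum
  have h'' : ∀ s ∈ Finset.range (m + 1), ((-1) ^ (s + 1) *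
      (eN (s + 1) * hN (m + 1 - (s + 1))) : SymF) =
      (-1) * ((-1) ^ s * (eN (s + 1) * hN (m - s))) := by
    intro s _
    rw [Nat.add_sub_add_right]
    ring
  rw [Finset.sum_congr rfl h'', ← Finset.mul_sum, pow_zero, Nat.sub_zero,
    show eN 0 = 1 by rw [eN]] at hsum
  linear_combination -hsum

end Operators

section CompositionLists

/-- The compositions of `n`, as lists of positive integers. -/
def compLists (n : ℕ) : Finset (List ℕ) :=
  Finset.univ.image fun c : Composition n => c.blocks

theorem mem_compLists {n : ℕ} {x : List ℕ} :
    x ∈ compLists n ↔ (∀ i ∈ x, 0 < i) ∧ x.sum = n := by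
  rw [compLists, Finset.mem_image]
  constructor
  · rintro ⟨c, -, rfl⟩
    exact ⟨fun i hi => c.blocks_pos hi, c.blocks_sum⟩
  · rintro ⟨hpos, hsum⟩
    exact ⟨⟨x, fun hi => hpos _ hi, hsum⟩, Finset.mem_univ _, rfl⟩

theorem blocks_injective (n : ℕ) :
    Function.Injective fun c : Composition n => c.blocks := fun _ _ h => Composition.ext h

/-- The proper partial sums of a list, including the empty one. -/
def partialSums : List ℕ → Finset ℕ
  | [] => ∅
  | a :: l => insert 0 ((partialSums l).image (a + ·))

theorem image_take_sum (l : List ℕ) :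
    ((Finset.range l.length).image fun i => (l.take i).sum) = partialSums l := by
  induction l with
  | nil => rfl
  | cons a l ih =>
    rw [partialSums, ← ih]
    ext s
    simp only [Finset.mem_image, Finset.mem_range, Finset.mem_insert, List.length_cons]
    constructor
    · rintro ⟨i, hi, rfl⟩
      cases i with
      | zero => simp
      | succ i => exact Or.inr ⟨_, ⟨i, by omega, rfl⟩, by simp⟩
    · rintro (rfl | ⟨_, ⟨i, hi, rfl⟩, rfl⟩)
      · exact ⟨0, by omega, by simp⟩
      · exact ⟨i + 1, by omega, by simp⟩

theorem touchSet_eq_partialSums {n : ℕ} (c : Composition n) :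
    touchSet c = partialSums c.blocks := image_take_sum c.blocks

theorem partialSums_append (x y : List ℕ) :
    partialSums (x ++ y) = partialSums x ∪ (partialSums y).image (x.sum + ·) := by
  induction x with
  | nil => simp [partialSums]
  | cons a x ih =>
    simp only [List.cons_append, partialSums, ih, Finset.image_union, Finset.image_image,
      List.sum_cons, Finset.insert_union]
    congr 3
    funext s
    simp [add_assoc]

theorem mem_partialSums_split {l : List ℕ} {s : ℕ} (h : s ∈ partialSums l) :
    ∃ x y, l = x ++ y ∧ x.sum = s := by
  rw [← image_take_sum, Finset.mem_image] at h
  obtain ⟨i, -, rfl⟩ := h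
  exact ⟨l.take i, l.drop i, (List.take_append_drop i l).symm, rfl⟩

theorem lt_sum_of_mem_partialSums {l : List ℕ} (hl : ∀ i ∈ l, 0 < i) {s : ℕ}
    (h : s ∈ partialSums l) : s < l.sum := by
  induction l generalizing s with
  | nil => simp [partialSums] at h
  | cons a l ih =>
    rw [partialSums, Finset.mem_insert, Finset.mem_image] at h
    have ha := hl a List.mem_cons_self
    rw [List.sum_cons]
    rcases h with rfl | ⟨t, ht, rfl⟩
    · omega
    · have := ih (fun i hi => hl i (List.mem_cons_of_mem _ hi)) ht
      omega

theorem card_partialSums {l : List ℕ} (hl : ∀ i ∈ l, 0 < i) :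
    (partialSums l).card = l.length := by
  induction l with
  | nil => rfl
  | cons a l ih =>
    have ha := hl a List.mem_cons_self
    rw [partialSums, Finset.card_insert_of_notMem,
      Finset.card_image_of_injective _ (add_right_injective a),
      ih fun i hi => hl i (List.mem_cons_of_mem _ hi), List.length_cons]
    rw [Finset.mem_image]
    rintro ⟨t, -, ht⟩
    omega

theorem zero_mem_partialSums {l : List ℕ} (hl : l ≠ []) : 0 ∈ partialSums l := by
  cases l with
  | nil => exact absurd rfl hl
  | cons a l => exact Finset.mem_insert_self _ _

/-- The refinements of a list of positive integers. -/
def refinements : List ℕ → Finset (List ℕ)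
  | [] => {[]}
  | a :: l => Finset.image₂ (· ++ ·) (compLists a) (refinements l)

theorem mem_refinements_cons {a : ℕ} {l x : List ℕ} :
    x ∈ refinements (a :: l) ↔ ∃ y ∈ compLists a, ∃ z ∈ refinements l, y ++ z = x := by
  rw [refinements, Finset.mem_image₂]

theorem pos_and_sum_of_mem_refinements {l x : List ℕ} (h : x ∈ refinements l) :
    (∀ i ∈ x, 0 < i) ∧ x.sum = l.sum := by
  induction l generalizing x with
  | nil =>
    rw [refinements, Finset.mem_singleton] at h
    simp [h]
  | cons a l ih =>
    obtain ⟨y, hy, z, hz, rfl⟩ := mem_refinements_cons.mp h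
    rw [mem_compLists] at hy
    obtain ⟨hz₁, hz₂⟩ := ih hz
    refine ⟨fun i hi => ?_, by rw [List.sum_append, List.sum_cons, hy.2, hz₂]⟩
    rcases List.mem_append.mp hi with h | h
    exacts [hy.1 i h, hz₁ i h]

theorem partialSums_subset_of_mem_refinements {l x : List ℕ} (hl : ∀ i ∈ l, 0 < i)
    (h : x ∈ refinements l) : partialSums l ⊆ partialSums x := by
  induction l generalizing x with
  | nil => simp [partialSums]
  | cons a l ih =>
    obtain ⟨y, hy, z, hz, rfl⟩ := mem_refinements_cons.mp h
    rw [mem_compLists] at hy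
    have hy0 : y ≠ [] := by
      rintro rfl
      have := hl a List.mem_cons_self
      simp at hy
      omega
    rw [partialSums_append, partialSums, hy.2]
    refine Finset.insert_subset (Finset.mem_union_left _ (zero_mem_partialSums hy0)) ?_
    exact (Finset.image_subset_image (ih (fun i hi => hl i (List.mem_cons_of_mem _ hi)) hz)).trans
      Finset.subset_union_right

theorem mem_refinements_of_partialSums_subset {l x : List ℕ} (hx : ∀ i ∈ x, 0 < i)
    (hsum : x.sum = l.sum) (h : partialSums l ⊆ partialSums x) : x ∈ refinements l := by
  induction l generalizing x with
  | nil =>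
    rw [refinements, Finset.mem_singleton]
    cases x with
    | nil => rfl
    | cons b x =>
      have := hx b List.mem_cons_self
      simp at hsum
      omega
  | cons a l ih =>
    obtain ⟨y, z, rfl, hy⟩ : ∃ y z, x = y ++ z ∧ y.sum = a := by
      by_cases hl : l = []
      · exact ⟨x, [], by simp, by simpa [hl] using hsum⟩
      · refine mem_partialSums_split (h ?_)
        rw [partialSums]
        exact Finset.mem_insert_of_mem
          (Finset.mem_image.mpr ⟨0, zero_mem_partialSums hl, add_zero a⟩)
    have hypos : ∀ i ∈ y, 0 < i := fun i hi => hx i (List.mem_append_left _ hi)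
    refine mem_refinements_cons.mpr ⟨y, mem_compLists.mpr ⟨hypos, hy⟩, z, ih ?_ ?_ ?_, rfl⟩
    · exact fun i hi => hx i (List.mem_append_right _ hi)
    · rw [List.sum_append, List.sum_cons] at hsum
      omega
    · intro s hs
      have hs' : a + s ∈ partialSums (y ++ z) := h (by
        rw [partialSums]
        exact Finset.mem_insert_of_mem (Finset.mem_image_of_mem _ hs))
      rw [partialSums_append, Finset.mem_union, Finset.mem_image, hy] at hs'
      rcases hs' with hs' | ⟨t, ht, hts⟩
      · have := lt_sum_of_mem_partialSums hypos hs'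
        omega
      · obtain rfl : t = s := by omega
        exact ht

theorem sum_refines_eq {M : Type*} [AddCommMonoid M] {n : ℕ} (α : Composition n)
    (f : List ℕ → M) :
    ∑ β ∈ Finset.univ.filter fun β : Composition n => Refines β α, f β.blocks =
      ∑ x ∈ refinements α.blocks, f x := by
  rw [← Finset.sum_image (g := fun β : Composition n => β.blocks) (f := f)
    fun _ _ _ _ h => blocks_injective n h]
  congr 1
  ext x
  simp only [Finset.mem_image, Finset.mem_filter, Finset.mem_univ, true_and, Refines,
    touchSet_eq_partialSums]
  constructor
  · rintro ⟨β, hβ, rfl⟩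
    exact mem_refinements_of_partialSums_subset (fun i hi => β.blocks_pos hi)
      (β.blocks_sum.trans α.blocks_sum.symm) hβ
  · intro hx
    obtain ⟨h₁, h₂⟩ := pos_and_sum_of_mem_refinements hx
    exact ⟨⟨x, fun hi => h₁ _ hi, h₂.trans α.blocks_sum⟩,
      partialSums_subset_of_mem_refinements (fun i hi => α.blocks_pos hi) hx, rfl⟩

theorem append_inj_of_sum_eq {y y' z z' : List ℕ} (hy : ∀ i ∈ y, 0 < i) (hy' : ∀ i ∈ y', 0 < i)
    (hsum : y.sum = y'.sum) (h : y ++ z = y' ++ z') : y = y' ∧ z = z' := by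
  induction y generalizing y' with
  | nil =>
    cases y' with
    | nil => exact ⟨rfl, h⟩
    | cons b y' =>
      have := hy' b List.mem_cons_self
      simp at hsum
      omega
  | cons a y ih =>
    cases y' with
    | nil =>
      have := hy a List.mem_cons_self
      simp at hsum
      omega
    | cons b y' =>
      simp only [List.cons_append, List.cons.injEq] at h
      obtain ⟨rfl, h⟩ := h
      obtain ⟨rfl, rfl⟩ := ih (fun i hi => hy i (List.mem_cons_of_mem _ hi))
        (fun i hi => hy' i (List.mem_cons_of_mem _ hi)) (by simpa using hsum) h
      exact ⟨rfl, rfl⟩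

theorem sum_refinements_cons {M : Type*} [AddCommMonoid M] (a : ℕ) (l : List ℕ)
    (f : List ℕ → M) :
    ∑ x ∈ refinements (a :: l), f x =
      ∑ y ∈ compLists a, ∑ z ∈ refinements l, f (y ++ z) := by
  rw [refinements, ← Finset.image_uncurry_product, Finset.sum_image, Finset.sum_product]
  · rfl
  · rintro ⟨y, z⟩ h ⟨y', z'⟩ h' heq
    simp only [Finset.coe_product, Set.mem_prod, Finset.mem_coe, mem_compLists] at h h'
    obtain ⟨rfl, rfl⟩ := append_inj_of_sum_eq h.1.1 h'.1.1 (h.1.2.trans h'.1.2.symm) heq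
    rfl

theorem compLists_zero : compLists 0 = {[]} := by
  ext x
  rw [mem_compLists, Finset.mem_singleton]
  constructor
  · rintro ⟨h, hs⟩
    cases x with
    | nil => rfl
    | cons b x =>
      have := h b List.mem_cons_self
      simp at hs
      omega
  · rintro rfl
    simp

theorem sum_compLists_succ {M : Type*} [AddCommMonoid M] (m : ℕ) (f : List ℕ → M) :
    ∑ x ∈ compLists (m + 1), f x =
      ∑ k ∈ Finset.range (m + 1), ∑ y ∈ compLists (m - k), f ((k + 1) :: y) := by
  rw [Finset.sum_sigma']
  symm
  refine Finset.sum_bij (fun p _ => (p.1 + 1) :: p.2) ?_ ?_ ?_ fun _ _ => rfl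
  · rintro ⟨k, y⟩ h
    simp only [Finset.mem_sigma, Finset.mem_range, mem_compLists] at h
    refine mem_compLists.mpr ⟨fun i hi => ?_, by simp only [List.sum_cons]; omega⟩
    rcases List.mem_cons.mp hi with rfl | hi
    exacts [Nat.succ_pos _, h.2.1 i hi]
  · rintro ⟨k, y⟩ _ ⟨k', y'⟩ _ h
    simp only [List.cons.injEq, Nat.add_right_cancel_iff] at h
    obtain ⟨rfl, rfl⟩ := h
    rfl
  · intro x hx
    rw [mem_compLists] at hx
    cases x with
    | nil => simp at hx
    | cons b x =>
      have hb := hx.1 b List.mem_cons_self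
      have hs := hx.2
      rw [List.sum_cons] at hs
      obtain ⟨k, rfl⟩ := Nat.exists_eq_add_of_le' hb
      refine ⟨⟨k, x⟩, ?_, rfl⟩
      simp only [Finset.mem_sigma, Finset.mem_range, mem_compLists]
      exact ⟨by omega, fun i hi => hx.1 i (List.mem_cons_of_mem _ hi), by omega⟩

theorem sum_compLists_reverse {M : Type*} [AddCommMonoid M] (m : ℕ) (f : List ℕ → M) :
    ∑ x ∈ compLists m, f x.reverse = ∑ x ∈ compLists m, f x := by
  refine Finset.sum_nbij' List.reverse List.reverse ?_ ?_ ?_ ?_ ?_ <;>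
    simp [mem_compLists, List.sum_reverse]

/-- The statistic `doff` on lists of parts. -/
def doffList (A B : List ℕ) : ℕ :=
  ∑ k ∈ Finset.range A.length, (A.length - 1 - k) *
    ((partialSums B).filter fun s => (A.take k).sum ≤ s ∧ s < (A.take (k + 1)).sum).card

theorem doffC_eq_doffList {n : ℕ} (α β : Composition n) :
    doffC α β = doffList α.blocks β.blocks := by
  rw [doffC, touchSet_eq_partialSums]
  rfl

theorem doffList_cons_append {a : ℕ} {A y z : List ℕ} (hy : y ∈ compLists a) :
    doffList (a :: A) (y ++ z) = A.length * y.length + doffList A z := by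
  obtain ⟨hpos, hsum⟩ := mem_compLists.mp hy
  rw [doffList, List.length_cons, Finset.sum_range_succ', add_comm]
  congr 1
  · rw [← card_partialSums hpos, partialSums_append]
    congr 2
    ext s
    simp only [Finset.mem_filter, Finset.mem_union, Finset.mem_image, List.take_zero, List.sum_nil,
      zero_add, List.take_succ_cons, List.sum_cons, add_zero, zero_le, true_and]
    constructor
    · rintro ⟨h | ⟨t, -, rfl⟩, hs⟩
      · exact h
      · omega
    · intro h
      exact ⟨Or.inl h, hsum ▸ lt_sum_of_mem_partialSums hpos h⟩
  · refine Finset.sum_congr rfl fun k hk => ?_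
    rw [show A.length + 1 - 1 - (k + 1) = A.length - 1 - k by omega]
    congr 1
    rw [← Finset.card_image_of_injective ((partialSums z).filter _) (add_right_injective a),
      partialSums_append]
    congr 1
    ext s
    simp only [Finset.mem_filter, Finset.mem_union, Finset.mem_image, List.take_succ_cons,
      List.sum_cons, hsum]
    constructor
    · rintro ⟨h | ⟨t, ht, rfl⟩, h₁, h₂⟩
      · have := lt_sum_of_mem_partialSums hpos h
        omega
      · exact ⟨t, ⟨ht, by omega, by omega⟩, rfl⟩
    · rintro ⟨t, ⟨ht, h₁, h₂⟩, rfl⟩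
      exact ⟨Or.inr ⟨t, ht, rfl⟩, by omega, by omega⟩

theorem doffList_append (a : ℕ) {A x : List ℕ} (y : List ℕ) (hx : x ∈ refinements A) :
    doffList (A ++ [a]) (x ++ y) = x.length + doffList A x := by
  induction A generalizing x with
  | nil =>
    rw [refinements, Finset.mem_singleton] at hx
    subst hx
    simp [doffList]
  | cons b A ih =>
    obtain ⟨u, hu, v, hv, rfl⟩ := mem_refinements_cons.mp hx
    rw [List.cons_append, List.append_assoc, doffList_cons_append hu, ih hv,
      doffList_cons_append hu]
    simp only [List.length_append, List.length_cons, List.length_nil]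
    ring

theorem append_mem_refinements {a : ℕ} {A x y : List ℕ} (hx : x ∈ refinements A)
    (hy : y ∈ compLists a) : x ++ y ∈ refinements (A ++ [a]) := by
  induction A generalizing x with
  | nil =>
    rw [refinements, Finset.mem_singleton] at hx
    subst hx
    exact mem_refinements_cons.mpr ⟨y, hy, [], by simp [refinements], by simp⟩
  | cons b A ih =>
    obtain ⟨u, hu, v, hv, rfl⟩ := mem_refinements_cons.mp hx
    exact mem_refinements_cons.mpr ⟨u, hu, v ++ y, ih hv, by simp⟩

theorem reverse_mem_compLists {a : ℕ} {y : List ℕ} (hy : y ∈ compLists a) :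
    y.reverse ∈ compLists a := by
  simpa [mem_compLists, List.sum_reverse] using hy

theorem reverse_mem_refinements {A x : List ℕ} (hx : x ∈ refinements A) :
    x.reverse ∈ refinements A.reverse := by
  induction A generalizing x with
  | nil =>
    rw [refinements, Finset.mem_singleton] at hx
    subst hx
    simp [refinements]
  | cons a A ih =>
    obtain ⟨y, hy, z, hz, rfl⟩ := mem_refinements_cons.mp hx
    rw [List.reverse_append, List.reverse_cons]
    exact append_mem_refinements (ih hz) (reverse_mem_compLists hy)

theorem doffList_reverse_cons_append (a : ℕ) {A z : List ℕ} (y : List ℕ)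
    (hz : z ∈ refinements A) :
    doffList (a :: A).reverse (y ++ z).reverse = z.length + doffList A.reverse z.reverse := by
  rw [List.reverse_append, List.reverse_cons,
    doffList_append _ _ (reverse_mem_refinements hz), List.length_reverse]

end CompositionLists

section CreationProducts

/-- The operator `𝔹_{α_ℓ} ⋯ 𝔹_{α₁}`. -/
noncomputable def bProduct : List ℕ → (SymF →ₗ[F] SymF)
  | [] => LinearMap.id
  | a :: l => (bProduct l).comp (creationOp (bWeight a))

/-- The operator `ℂ_m` for `m ≥ 0`, as a linear map. -/
noncomputable def cLinear (m : ℕ) : SymF →ₗ[F] SymF :=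
  ((-q⁻¹ : F) ^ ((m : ℤ) - 1)) • creationOp (cWeight m)

/-- The operator `ℂ_{α₁} ⋯ ℂ_{α_ℓ}`. -/
noncomputable def cProduct : List ℕ → (SymF →ₗ[F] SymF)
  | [] => LinearMap.id
  | a :: l => (cLinear a).comp (cProduct l)

theorem Cop_eq_cLinear (m : ℕ) (P : SymF) : Cop m P = cLinear m P := Cop_eq_creationOp m P

theorem Bfun_eq_bProduct (l : List ℕ) : Bfun l = bProduct l 1 := by
  have h : ∀ P, (l.map fun a : ℕ => (a : ℤ)).foldl (fun acc a => Bop a acc) P = bProduct l P := by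
    induction l with
    | nil => exact fun _ => rfl
    | cons a l ih =>
      intro P
      rw [List.map_cons, List.foldl_cons, ih, Bop_eq_creationOp]
      rfl
  simpa [Bfun, List.map_eq_flatMap] using h 1

theorem Cfun_eq_cProduct (l : List ℕ) : Cfun l = cProduct l 1 := by
  induction l with
  | nil => rfl
  | cons a l ih =>
    rw [Cfun, Cop_eq_cLinear, ih]
    rfl

theorem bProduct_append (x y : List ℕ) (P : SymF) :
    bProduct (x ++ y) P = bProduct y (bProduct x P) := by
  induction x generalizing P with
  | nil => rfl
  | cons a x ih => exact ih _

theorem cProduct_append (x y : List ℕ) (P : SymF) :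
    cProduct (x ++ y) P = cProduct x (cProduct y P) := by
  induction x with
  | nil => rfl
  | cons a x ih => exact congrArg (cLinear a) ih

theorem creationOp_cProduct (m : ℕ) {y : List ℕ} (hy : ∀ i ∈ y, 0 < i) (P : SymF) :
    creationOp (bWeight m) (cProduct y P) =
      q ^ y.length • cProduct y (creationOp (bWeight m) P) := by
  induction y with
  | nil => simp [cProduct]
  | cons a y ih =>
    have ha := hy a List.mem_cons_self
    have h := Bop_Cop (m := m) (n := a) (by omega) (cProduct y P)
    rw [Bop_eq_creationOp, Bop_eq_creationOp, Cop_eq_cLinear, Cop_eq_cLinear,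
      ih fun i hi => hy i (List.mem_cons_of_mem _ hi), map_smul, smul_smul] at h
    rw [List.length_cons, pow_succ']
    exact h

theorem bProduct_cProduct (l : List ℕ) {y : List ℕ} (hy : ∀ i ∈ y, 0 < i) (P : SymF) :
    bProduct l (cProduct y P) = q ^ (l.length * y.length) • cProduct y (bProduct l P) := by
  induction l generalizing P with
  | nil => simp [bProduct]
  | cons a l ih =>
    rw [bProduct, LinearMap.comp_apply, LinearMap.comp_apply, creationOp_cProduct a hy, map_smul,
      ih, smul_smul, List.length_cons, ← pow_add]
    congr 2
    ring

theorem eN_eq_sum_cProduct (a : ℕ) : eN a = ∑ y ∈ compLists a, cProduct y 1 := by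
  induction a using Nat.strong_induction_on with
  | _ a ih =>
    cases a with
    | zero => simp [compLists_zero, cProduct, eN]
    | succ m =>
      rw [sum_compLists_succ, ← sum_Cop_eN]
      refine Finset.sum_congr rfl fun k _ => ?_
      rw [Cop_eq_cLinear, ih (m - k) (by omega), map_sum]
      rfl

theorem hN_eq_sum_bProduct (a : ℕ) :
    ((-q⁻¹) ^ a) • hN a = ∑ y ∈ compLists a, ((-q⁻¹) ^ y.length) • bProduct y 1 := by
  rw [← sum_compLists_reverse]
  induction a using Nat.strong_induction_on with
  | _ a ih =>
    cases a with
    | zero => simp [compLists_zero, bProduct, hN]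
    | succ m =>
      rw [sum_compLists_succ, ← sum_Bop_hN, Finset.smul_sum]
      refine Finset.sum_congr rfl fun k hk => ?_
      obtain ⟨d, rfl⟩ := Nat.exists_eq_add_of_le (Nat.lt_succ_iff.mp (Finset.mem_range.mp hk))
      have h := ih d (by omega)
      rw [Nat.add_sub_cancel_left, Bop_eq_creationOp]
      have h' : ∀ y : List ℕ, ((-q⁻¹) ^ ((k + 1) :: y).reverse.length) •
          bProduct ((k + 1) :: y).reverse 1 = (-q⁻¹) • creationOp (bWeight (k + 1))
            (((-q⁻¹) ^ y.reverse.length) • bProduct y.reverse 1) := by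
        intro y
        rw [List.reverse_cons, bProduct_append, List.length_append, map_smul, smul_smul,
          List.length_singleton, pow_succ']
        rfl
      simp only [h']
      rw [← Finset.smul_sum, ← map_sum, ← h, map_smul, smul_smul, smul_smul]
      congr 1
      have hq : (-q⁻¹) ^ k * (-q) ^ k = 1 := by
        rw [← mul_pow, neg_mul_neg, inv_mul_cancel₀ q_ne_zero, one_pow]
      rw [pow_succ, pow_add]
      linear_combination (-q⁻¹) * (-q⁻¹) ^ d * hq

theorem cLinear_one (a : ℕ) :
    cLinear a 1 = ∑ y ∈ compLists a, ((-q) * (-q⁻¹) ^ y.length) • bProduct y 1 := by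
  simp only [mul_smul]
  rw [← Finset.smul_sum, ← hN_eq_sum_bProduct, smul_smul, ← Cop_eq_cLinear, Cop_one]
  congr 1
  have h : (-q⁻¹ : F) ≠ 0 := neg_ne_zero.mpr (inv_ne_zero q_ne_zero)
  rw [zpow_sub_one₀ h, zpow_natCast, inv_neg, inv_inv, mul_comm]

theorem bProduct_eq_sum_refinements (l : List ℕ) :
    bProduct l 1 = ∑ x ∈ refinements l, (q ^ doffList l x) • cProduct x 1 := by
  induction l with
  | nil => simp [refinements, doffList, bProduct, cProduct]
  | cons a l ih =>
    rw [sum_refinements_cons, bProduct, LinearMap.comp_apply, ← Bop_eq_creationOp, Bop_one,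
      eN_eq_sum_cProduct, map_sum]
    refine Finset.sum_congr rfl fun y hy => ?_
    rw [bProduct_cProduct l (mem_compLists.mp hy).1, ih, map_sum, Finset.smul_sum]
    refine Finset.sum_congr rfl fun z _ => ?_
    rw [doffList_cons_append hy, cProduct_append, map_smul, smul_smul, ← pow_add]

theorem cProduct_eq_sum_refinements {l : List ℕ} (hl : ∀ i ∈ l, 0 < i) :
    cProduct l 1 = ∑ x ∈ refinements l, ((-q) ^ ((l.length : ℤ) - x.length) *
      q ^ (-(doffList l.reverse x.reverse : ℤ))) • bProduct x 1 := by
  induction l with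
  | nil => simp [refinements, doffList, bProduct, cProduct]
  | cons a l ih =>
    have hq := q_ne_zero
    have hq' : -q ≠ 0 := neg_ne_zero.mpr hq
    rw [sum_refinements_cons, Finset.sum_comm, cProduct, LinearMap.comp_apply,
      ih fun i hi => hl i (List.mem_cons_of_mem _ hi), map_sum]
    refine Finset.sum_congr rfl fun z hz => ?_
    have hcomm : cLinear a (bProduct z 1) = (q⁻¹ ^ z.length) • bProduct z (cLinear a 1) := by
      have h := bProduct_cProduct z (y := [a]) (by simpa using hl a List.mem_cons_self) 1
      rw [List.length_singleton, mul_one] at h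
      change bProduct z (cLinear a 1) = q ^ z.length • cLinear a (bProduct z 1) at h
      rw [h, smul_smul, ← mul_pow, inv_mul_cancel₀ hq, one_pow, one_smul]
    rw [map_smul, hcomm, cLinear_one, map_sum, Finset.smul_sum, Finset.smul_sum]
    refine Finset.sum_congr rfl fun y _ => ?_
    rw [map_smul, smul_smul, smul_smul, bProduct_append, doffList_reverse_cons_append a y hz]
    congr 1
    rw [List.length_cons, List.length_append,
      show ((l.length + 1 : ℕ) : ℤ) - ((y.length + z.length : ℕ) : ℤ) =
        ((l.length : ℤ) - z.length) + 1 + (-(y.length : ℤ)) by push_cast; ring,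
      show -((z.length + doffList l.reverse z.reverse : ℕ) : ℤ) =
        -(z.length : ℤ) + -(doffList l.reverse z.reverse : ℤ) by push_cast; ring,
      zpow_add₀ hq', zpow_add₀ hq', zpow_add₀ hq, zpow_one, zpow_neg (-q) (y.length : ℤ),
      zpow_neg q (z.length : ℤ), zpow_natCast, zpow_natCast, inv_pow, ← inv_neg, inv_pow]
    ring

end CreationProducts

/-- for any composition `α` of `n`,
`B_α = ∑_{β ≤ α} q^{doff_α(DP(β))} C_β` and, by inversion,
`C_α = ∑_{β ≤ α} (-q)^{ℓ(α)-ℓ(β)} q^{-doff_{rev α}(DP(rev β))} B_β`. -/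
theorem stmt19 (n : ℕ) (α : Composition n) :
    (Bfun α.blocks =
        ∑ β ∈ Finset.univ.filter fun β : Composition n => Refines β α,
          ((q : F) ^ doffC α β) • Cfun β.blocks) ∧
      (Cfun α.blocks =
        ∑ β ∈ Finset.univ.filter fun β : Composition n => Refines β α,
          (((-q : F) ^ ((α.length : ℤ) - β.length)) *
              (q : F) ^ (-(doffC (revC α) (revC β) : ℤ))) • Bfun β.blocks) := by
  simp only [Bfun_eq_bProduct, Cfun_eq_cProduct, doffC_eq_doffList]
  refine ⟨?_, ?_⟩
  · rw [bProduct_eq_sum_refinements]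
    exact (sum_refines_eq α fun x => (q ^ doffList α.blocks x) • cProduct x 1).symm
  · rw [cProduct_eq_sum_refinements fun i hi => α.blocks_pos hi]
    exact (sum_refines_eq α fun x => ((-q) ^ ((α.blocks.length : ℤ) - x.length) *
      q ^ (-(doffList α.blocks.reverse x.reverse : ℤ))) • bProduct x 1).symm
end
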